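/- Let s ∈ (−3/8, −1/3) and b ∈ (3/8, 1/2). Then there exist b' ∈ (−1/2, −5/12) and C > 0 such that for all measurable functions f₁, f₂ : ℤ² × ℝ → [0,∞): Σ_{k ∈ ℤ²} ∫_ℝ ⟨k⟩^{2s} ⟨τ + |k|²⟩^{2b'} ( Σ_{k₁ ∈ ℤ²} ∫_ℝ ⟨k₁⟩^{−s} ⟨τ₁ − |k₁|²⟩^{−b} f₁(k₁, τ₁) · ⟨k−k₁⟩^{−s} ⟨τ−τ₁ − |k−k₁|²⟩^{−b} f₂(k−k₁, τ−τ₁) dτ₁ )² dτ ≤ C ( Σ_{k ∈ ℤ²} ∫_ℝ f₁(k,τ)² dτ ) ( Σ_{k ∈ ℤ²} ∫_ℝ f₂(k,τ)² dτ ). -/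

import Mathlib

open MeasureTheory

/-- Japanese bracket `⟨y⟩ = (1 + y²)^{1/2}`. -/
noncomputable def jb (y : ℝ) : ℝ := Real.sqrt (1 + y ^ 2)

/-- `|k|²` for `k ∈ ℤ²`. -/
noncomputable def zn2 (k : Fin 2 → ℤ) : ℝ := ∑ j, ((k j : ℝ)) ^ 2

/-- `⟨k⟩ = (1 + |k|²)^{1/2}` for `k ∈ ℤ²`. -/
noncomputable def jbk (k : Fin 2 → ℤ) : ℝ := Real.sqrt (1 + zn2 k)

theorem sq_lintegral_mul_le {α : Type*} [MeasurableSpace α] (μ : Measure α) {f g : α → ENNReal}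
    (hf : AEMeasurable f μ) (hg : AEMeasurable g μ) :
    (∫⁻ a, f a * g a ∂μ) ^ 2 ≤ (∫⁻ a, f a ^ 2 ∂μ) * ∫⁻ a, g a ^ 2 ∂μ := by
  have h := ENNReal.lintegral_mul_le_Lp_mul_Lq μ Real.HolderConjugate.two_two hf hg
  simp only [Pi.mul_apply, ENNReal.rpow_ofNat] at h
  calc _ ≤ _ := pow_le_pow_left' h 2
    _ = _ := by
      rw [mul_pow, ← ENNReal.rpow_two, ← ENNReal.rpow_two, ← ENNReal.rpow_mul, ← ENNReal.rpow_mul]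
      norm_num

theorem sq_tsum_mul_le {ι : Type*} (f g : ι → ENNReal) :
    (∑' i, f i * g i) ^ 2 ≤ (∑' i, f i ^ 2) * ∑' i, g i ^ 2 := by
  let _ : MeasurableSpace ι := ⊤
  have h := sq_lintegral_mul_le (Measure.count : Measure ι) (f := f) (g := g)
    (measurable_from_top).aemeasurable (measurable_from_top).aemeasurable
  simpa only [lintegral_count] using h

theorem lintegral_sq_tsum_le {α ι : Type*} [MeasurableSpace α] [Countable ι] (μ : Measure α)
    {G : ι → α → ENNReal} (hG : ∀ i, Measurable (G i)) :
    ∫⁻ a, (∑' i, G i a) ^ 2 ∂μ ≤ (∑' i, (∫⁻ a, G i a ^ 2 ∂μ) ^ (1 / 2 : ℝ)) ^ 2 := by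
  have hmul : ∀ i j, ∫⁻ a, G i a * G j a ∂μ ≤
      (∫⁻ a, G i a ^ 2 ∂μ) ^ (1 / 2 : ℝ) * (∫⁻ a, G j a ^ 2 ∂μ) ^ (1 / 2 : ℝ) := fun i j => by
    have h := ENNReal.lintegral_mul_le_Lp_mul_Lq μ Real.HolderConjugate.two_two
      (hG i).aemeasurable (hG j).aemeasurable
    simpa only [Pi.mul_apply, ENNReal.rpow_ofNat] using h
  calc ∫⁻ a, (∑' i, G i a) ^ 2 ∂μ = ∫⁻ a, ∑' i, ∑' j, G i a * G j a ∂μ := by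
        simp only [sq, ENNReal.tsum_mul_left, ENNReal.tsum_mul_right]
    _ = ∑' i, ∑' j, ∫⁻ a, G i a * G j a ∂μ := by
        rw [lintegral_tsum fun i => (Measurable.tsum fun j =>
          (hG i).fun_mul (hG j)).aemeasurable]
        exact tsum_congr fun i => lintegral_tsum fun j => ((hG i).mul (hG j)).aemeasurable
    _ ≤ ∑' i, ∑' j, (∫⁻ a, G i a ^ 2 ∂μ) ^ (1 / 2 : ℝ) * (∫⁻ a, G j a ^ 2 ∂μ) ^ (1 / 2 : ℝ) :=
        ENNReal.tsum_le_tsum fun i => ENNReal.tsum_le_tsum fun j => hmul i j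
    _ = _ := by simp only [sq, ENNReal.tsum_mul_left, ENNReal.tsum_mul_right]

theorem lintegral_sq_le_of_forall_mul {α : Type*} [MeasurableSpace α] (μ : Measure α)
    [SigmaFinite μ] {G : α → ENNReal} {B : ENNReal}
    (h : ∀ g : α → ENNReal, Measurable g →
      (∫⁻ a, g a * G a ∂μ) ^ 2 ≤ B * ∫⁻ a, g a ^ 2 ∂μ) :
    ∫⁻ a, G a ^ 2 ∂μ ≤ B := by
  refine le_of_forall_lt fun L hL => ?_
  simp_rw [lintegral_eq_nnreal, lt_iSup_iff] at hL
  obtain ⟨g₀, hg₀, hL₀⟩ := hL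
  rw [← SimpleFunc.lintegral_eq_lintegral] at hL₀
  obtain ⟨g, hg, hfin, hLg⟩ := SimpleFunc.exists_lt_lintegral_simpleFunc_of_lt_lintegral hL₀
  have hgG : ∀ a, (g a : ENNReal) ≤ G a ^ 2 := fun a =>
    (ENNReal.coe_le_coe.2 (hg a)).trans (hg₀ a)
  refine hLg.trans_le ?_
  set I := ∫⁻ a, (g a : ENNReal) ∂μ with hI
  have hsq : ∀ a, ((g a : ENNReal) ^ (1 / 2 : ℝ)) ^ 2 = g a := fun a => by
    rw [← ENNReal.rpow_two, ← ENNReal.rpow_mul]; norm_num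
  have hle : ∀ a, (g a : ENNReal) ^ (1 / 2 : ℝ) ≤ G a := fun a => by
    have := ENNReal.rpow_le_rpow (hgG a) (by norm_num : (0 : ℝ) ≤ 1 / 2)
    rwa [← ENNReal.rpow_two (G a), ← ENNReal.rpow_mul, mul_one_div_cancel two_ne_zero,
      ENNReal.rpow_one] at this
  have hm : Measurable fun a => (g a : ENNReal) ^ (1 / 2 : ℝ) :=
    (g.measurable.coe_nnreal_ennreal).pow_const _
  have h1 : I ^ 2 ≤ B * I := by
    calc I ^ 2 ≤ (∫⁻ a, (g a : ENNReal) ^ (1 / 2 : ℝ) * G a ∂μ) ^ 2 := by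
          refine pow_le_pow_left' (lintegral_mono fun a => ?_) 2
          calc (g a : ENNReal) = (g a : ENNReal) ^ (1 / 2 : ℝ) * (g a : ENNReal) ^ (1 / 2 : ℝ) := by
                rw [← sq, hsq]
            _ ≤ _ := by gcongr; exact hle a
      _ ≤ B * ∫⁻ a, ((g a : ENNReal) ^ (1 / 2 : ℝ)) ^ 2 ∂μ := h _ hm
      _ = B * I := by simp only [hsq, hI]
  by_cases h0 : I = 0
  · simp [h0]
  · rw [sq] at h1
    exact (ENNReal.mul_le_mul_iff_left h0 hfin.ne).1 h1

theorem lintegral_sq_lintegral_kernel_le {α β : Type*} [MeasurableSpace α] [MeasurableSpace β]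
    (μ : Measure α) (ν : Measure β) [SigmaFinite μ] [SFinite ν]
    {F : β → ENNReal} {κ Φ : α → β → ENNReal} {S P : ENNReal}
    (hF : Measurable F) (hκ : Measurable (Function.uncurry κ))
    (hΦ : Measurable (Function.uncurry Φ))
    (hS : ∀ w, ∫⁻ z, κ z w ^ 2 ∂μ ≤ S) (hP : ∀ z, ∫⁻ w, Φ z w ^ 2 ∂ν ≤ P) :
    ∫⁻ z, (∫⁻ w, κ z w * (F w * Φ z w) ∂ν) ^ 2 ∂μ ≤ S * ((∫⁻ w, F w ^ 2 ∂ν) * P) := by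
  refine lintegral_sq_le_of_forall_mul μ fun g hg => ?_
  have mκ : ∀ w, Measurable fun z => κ z w := fun w => hκ.comp measurable_prodMk_right
  have mΦ : ∀ w, Measurable fun z => Φ z w := fun w => hΦ.comp measurable_prodMk_right
  have hH : Measurable fun p : β × α => κ p.2 p.1 * (g p.2 * Φ p.2 p.1) :=
    (hκ.comp measurable_swap).mul ((hg.comp measurable_snd).mul (hΦ.comp measurable_swap))
  calc (∫⁻ z, g z * ∫⁻ w, κ z w * (F w * Φ z w) ∂ν ∂μ) ^ 2
      = (∫⁻ w, F w * ∫⁻ z, κ z w * (g z * Φ z w) ∂μ ∂ν) ^ 2 := by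
        congr 1
        calc _ = ∫⁻ z, ∫⁻ w, F w * (κ z w * (g z * Φ z w)) ∂ν ∂μ := by
              refine lintegral_congr fun z => ?_
              rw [← lintegral_const_mul]
              · exact lintegral_congr fun w => by ring
              · exact (hκ.comp measurable_prodMk_left).mul
                  (hF.mul (hΦ.comp measurable_prodMk_left))
          _ = ∫⁻ w, ∫⁻ z, F w * (κ z w * (g z * Φ z w)) ∂μ ∂ν := by
              refine lintegral_lintegral_swap (Measurable.aemeasurable ?_)
              exact (hF.comp measurable_snd).mul (hκ.mul ((hg.comp measurable_fst).mul hΦ))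
          _ = _ := by
              refine lintegral_congr fun w => ?_
              rw [lintegral_const_mul]
              exact (mκ w).mul (hg.mul (mΦ w))
    _ ≤ (∫⁻ w, F w ^ 2 ∂ν) * ∫⁻ w, (∫⁻ z, κ z w * (g z * Φ z w) ∂μ) ^ 2 ∂ν :=
        sq_lintegral_mul_le ν hF.aemeasurable (hH.lintegral_prod_right').aemeasurable
    _ ≤ (∫⁻ w, F w ^ 2 ∂ν) * ∫⁻ w, S * ∫⁻ z, (g z * Φ z w) ^ 2 ∂μ ∂ν := by
        gcongr with w
        exact (sq_lintegral_mul_le μ (mκ w).aemeasurable (hg.mul (mΦ w)).aemeasurable).trans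
          (mul_le_mul_left (hS w) _)
    _ = (∫⁻ w, F w ^ 2 ∂ν) * (S * ∫⁻ z, g z ^ 2 * ∫⁻ w, Φ z w ^ 2 ∂ν ∂μ) := by
        rw [lintegral_const_mul]
        · rw [lintegral_lintegral_swap]
          · congr 2
            refine lintegral_congr fun z => ?_
            rw [← lintegral_const_mul]
            · simp only [mul_pow]
            · exact (hΦ.comp measurable_prodMk_left).pow_const 2
          · exact (((hg.comp measurable_snd).mul (hΦ.comp measurable_swap)).pow_const 2).aemeasurable
        · exact Measurable.lintegral_prod_right'
            (f := fun p : β × α => (g p.2 * Φ p.2 p.1) ^ 2)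
            (((hg.comp measurable_snd).mul (hΦ.comp measurable_swap)).pow_const 2)
    _ ≤ (∫⁻ w, F w ^ 2 ∂ν) * (S * ∫⁻ z, g z ^ 2 * P ∂μ) := by
        gcongr with z
        exact hP z
    _ = S * ((∫⁻ w, F w ^ 2 ∂ν) * P) * ∫⁻ z, g z ^ 2 ∂μ := by
        rw [lintegral_mul_const _ (hg.pow_const 2)]
        ring

theorem jb_sq (y : ℝ) : jb y ^ 2 = 1 + y ^ 2 := Real.sq_sqrt (by positivity)

theorem one_le_jb (y : ℝ) : 1 ≤ jb y := Real.one_le_sqrt.2 (by nlinarith [sq_nonneg y])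

theorem jb_pos (y : ℝ) : 0 < jb y := zero_lt_one.trans_le (one_le_jb y)

theorem abs_le_jb (y : ℝ) : |y| ≤ jb y := Real.abs_le_sqrt (by linarith)

theorem jb_le_one_add_abs (y : ℝ) : jb y ≤ 1 + |y| :=
  Real.sqrt_le_iff.2 ⟨by positivity, by nlinarith [sq_abs y, abs_nonneg y]⟩

theorem jb_neg (y : ℝ) : jb (-y) = jb y := by simp [jb]

theorem jb_add_le (x y : ℝ) : jb (x + y) ≤ jb x + |y| := by
  refine Real.sqrt_le_iff.2 ⟨by positivity [jb_pos x], ?_⟩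
  nlinarith [jb_sq x, sq_abs y, abs_le_jb x, abs_nonneg y, abs_mul_abs_self x,
    le_abs_self (x * y), abs_mul x y, mul_le_mul_of_nonneg_right (abs_le_jb x) (abs_nonneg y)]

theorem continuous_jb : Continuous jb := by unfold jb; fun_prop

theorem measurable_jb : Measurable jb := continuous_jb.measurable

theorem jb_rpow_neg_le_one (y : ℝ) {e : ℝ} (he : 0 ≤ e) : jb y ^ (-e) ≤ 1 :=
  Real.rpow_le_one_of_one_le_of_nonpos (one_le_jb y) (by linarith)

theorem rpow_neg_le_of_le_mul {x y c e : ℝ} (hx : 0 < x) (hc : 0 < c) (he : 0 ≤ e)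
    (h : x ≤ c * y) : y ^ (-e) ≤ c ^ e * x ^ (-e) := by
  have hy : 0 < y := pos_of_mul_pos_right (hx.trans_le h) hc.le
  have h1 : (c * y) ^ (-e) ≤ x ^ (-e) := Real.rpow_le_rpow_of_nonpos hx h (by linarith)
  rw [Real.mul_rpow hc.le hy.le, Real.rpow_neg hc.le] at h1
  have := Real.rpow_pos_of_pos hc e
  rwa [inv_mul_le_iff₀ this] at h1

theorem summable_jb_int {e : ℝ} (he : 1 < e) : Summable fun z : ℤ => jb z ^ (-e) := by
  have h0 : Summable fun z : ℤ => if z = 0 then (1 : ℝ) else 0 :=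
    (hasSum_ite_eq (0 : ℤ) (1 : ℝ)).summable
  refine ((Real.summable_abs_int_rpow he).add h0).of_nonneg_of_le
    (fun z => Real.rpow_nonneg (jb_pos _).le _) fun z => ?_
  by_cases hz : z = 0
  · have := jb_rpow_neg_le_one (z : ℝ) (by linarith : 0 ≤ e)
    have h2 := Real.rpow_nonneg (abs_nonneg (z : ℝ)) (-e)
    simp only [hz, if_true] at *
    linarith
  · have : 0 < |(z : ℝ)| := by simpa using hz
    simpa [hz] using Real.rpow_le_rpow_of_nonpos this (abs_le_jb z) (by linarith : -e ≤ 0)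

theorem exists_tsum_jb_int_sub_le {e : ℝ} (he : 1 < e) :
    ∃ C : ENNReal, C ≠ ⊤ ∧ ∀ r : ℝ, ∑' z : ℤ, ENNReal.ofReal (jb (z - r) ^ (-e)) ≤ C := by
  refine ⟨_, ((summable_jb_int he).mul_left (2 ^ e)).tsum_ofReal_ne_top, fun r => ?_⟩
  rw [← (Equiv.addRight ⌊r⌋).tsum_eq]
  refine ENNReal.tsum_le_tsum fun z => ENNReal.ofReal_le_ofReal ?_
  refine rpow_neg_le_of_le_mul (jb_pos _) two_pos (by linarith) ?_
  have h := jb_add_le ((z : ℝ) - Int.fract r) (Int.fract r)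
  rw [abs_of_nonneg (Int.fract_nonneg r), sub_add_cancel] at h
  have h1 := one_le_jb ((z : ℝ) - Int.fract r)
  have h2 := Int.fract_lt_one r
  have h3 : (((Equiv.addRight ⌊r⌋) z : ℤ) : ℝ) - r = z - Int.fract r := by
    rw [Equiv.coe_addRight, Int.cast_add]
    linarith [Int.self_sub_floor r]
  rw [h3]
  linarith

theorem jb_sq_le_two_mul_jb {d u : ℝ} (h : d ^ 2 ≤ |u|) : jb d ^ 2 ≤ 2 * jb u := by
  rw [jb_sq]
  linarith [one_le_jb u, abs_le_jb u]

theorem sq_abs_sub_sqrt_le (μ z : ℝ) : (|z| - √μ) ^ 2 ≤ |μ - z ^ 2| := by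
  rcases le_total 0 μ with h | h
  · have : |μ - z ^ 2| = |(|z| - √μ)| * (|z| + √μ) := by
      rw [← abs_of_nonneg (by positivity : 0 ≤ |z| + √μ), ← abs_mul, abs_sub_comm]
      congr 1
      nlinarith [Real.sq_sqrt h, sq_abs z]
    rw [this, ← sq_abs, sq]
    refine mul_le_mul_of_nonneg_left ?_ (abs_nonneg _)
    exact abs_sub_le_iff.2 ⟨by linarith [Real.sqrt_nonneg μ], by linarith [abs_nonneg z]⟩
  · rw [Real.sqrt_eq_zero_of_nonpos h, sub_zero, sq_abs, abs_sub_comm]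
    exact le_trans (by linarith) (le_abs_self _)

theorem exists_tsum_jb_abs_sub_le {e : ℝ} (he : 1 < e) :
    ∃ C : ENNReal, C ≠ ⊤ ∧ ∀ r : ℝ, ∑' z : ℤ, ENNReal.ofReal (jb (|(z : ℝ)| - r) ^ (-e)) ≤ C := by
  obtain ⟨C, hC, h⟩ := exists_tsum_jb_int_sub_le he
  refine ⟨C + C, by simp [hC], fun r => ?_⟩
  calc _ ≤ ∑' z : ℤ, (ENNReal.ofReal (jb (z - r) ^ (-e)) +
          ENNReal.ofReal (jb (z - -r) ^ (-e))) := by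
        refine ENNReal.tsum_le_tsum fun z => ?_
        rcases abs_choice (z : ℝ) with hz | hz
        · rw [hz]; exact le_self_add
        · rw [hz, ← jb_neg, neg_sub, sub_neg_eq_add r, add_comm r, ← sub_neg_eq_add]
          exact le_add_self
    _ ≤ C + C := by
        rw [ENNReal.tsum_add]
        exact add_le_add (h r) (h (-r))

theorem exists_tsum_jb_sub_sq_le {ρ : ℝ} (hρ : 1 / 2 < ρ) :
    ∃ C : ENNReal, C ≠ ⊤ ∧
      ∀ μ : ℝ, ∑' z : ℤ, ENNReal.ofReal (jb (μ - (z : ℝ) ^ 2) ^ (-ρ)) ≤ C := by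
  obtain ⟨C, hC, h⟩ := exists_tsum_jb_abs_sub_le (by linarith : 1 < 2 * ρ)
  refine ⟨ENNReal.ofReal (2 ^ ρ) * C, ENNReal.mul_ne_top ENNReal.ofReal_ne_top hC, fun μ => ?_⟩
  calc _ ≤ ∑' z : ℤ, ENNReal.ofReal (2 ^ ρ) *
          ENNReal.ofReal (jb (|(z : ℝ)| - √μ) ^ (-(2 * ρ))) := by
        refine ENNReal.tsum_le_tsum fun z => ?_
        rw [← ENNReal.ofReal_mul (by positivity)]
        refine ENNReal.ofReal_le_ofReal ?_
        have := rpow_neg_le_of_le_mul (pow_pos (jb_pos _) 2) two_pos (by linarith : 0 ≤ ρ)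
          (jb_sq_le_two_mul_jb (sq_abs_sub_sqrt_le μ z))
        rwa [← Real.rpow_natCast (jb _), ← Real.rpow_mul (jb_pos _).le, Nat.cast_ofNat,
          mul_neg] at this
    _ ≤ _ := by
        rw [ENNReal.tsum_mul_left]
        gcongr
        exact h _

theorem lintegral_jb_sub_ne_top {e : ℝ} (he : 1 < e) :
    ∫⁻ t : ℝ, ENNReal.ofReal (jb t ^ (-e)) ≠ ⊤ := by
  have h := integrable_rpow_neg_one_add_norm_sq (E := ℝ) (μ := volume) (r := e) (by simpa using he)
  refine ne_top_of_le_ne_top h.lintegral_lt_top.ne (lintegral_mono fun t => ?_)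
  rw [jb, Real.sqrt_eq_rpow, ← Real.rpow_mul (by positivity)]
  refine le_of_eq ?_
  congr 2
  · simp
  · ring

theorem jb_rpow_mul_jb_rpow_le {x y A B ρ : ℝ} (hρ : 0 ≤ ρ) (hA : ρ ≤ A) (hB : ρ ≤ B) :
    jb x ^ (-A) * jb y ^ (-B) ≤
      2 ^ ρ * jb (x - y) ^ (-ρ) * (jb x ^ (-(A + B - ρ)) + jb y ^ (-(A + B - ρ))) := by
  wlog h : jb y ≤ jb x generalizing x y A B
  · have := this hB hA (le_of_not_ge h)
    rw [← neg_sub, jb_neg] at this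
    calc _ = jb y ^ (-B) * jb x ^ (-A) := mul_comm _ _
      _ ≤ _ := this
      _ = _ := by rw [add_comm B A]; ring
  have hx := jb_pos x
  have hy := jb_pos y
  have h1 : jb (x - y) ≤ 2 * jb x := by
    have := jb_add_le x (-y)
    rw [abs_neg] at this
    rw [sub_eq_add_neg]
    linarith [abs_le_jb y]
  have h2 := rpow_neg_le_of_le_mul (jb_pos _) two_pos hρ h1
  have h3 : jb x ^ (-(A - ρ)) ≤ jb y ^ (-(A - ρ)) :=
    Real.rpow_le_rpow_of_nonpos hy h (by linarith)
  calc jb x ^ (-A) * jb y ^ (-B) = jb x ^ (-ρ) * (jb x ^ (-(A - ρ)) * jb y ^ (-B)) := by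
        rw [← mul_assoc, ← Real.rpow_add hx]; congr 2; ring
    _ ≤ (2 ^ ρ * jb (x - y) ^ (-ρ)) * (jb y ^ (-(A - ρ)) * jb y ^ (-B)) := by
        have := jb_pos (x - y)
        gcongr
    _ = (2 ^ ρ * jb (x - y) ^ (-ρ)) * jb y ^ (-(A + B - ρ)) := by
        rw [← Real.rpow_add hy]; congr 2; ring
    _ ≤ _ := by
        have := Real.rpow_nonneg hx.le (-(A + B - ρ))
        have := jb_pos (x - y)
        gcongr
        linarith

theorem exists_lintegral_jb_mul_jb_le {A B ρ : ℝ} (hρ : 0 ≤ ρ) (hA : ρ ≤ A) (hB : ρ ≤ B)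
    (h : 1 < A + B - ρ) :
    ∃ C : ENNReal, C ≠ ⊤ ∧ ∀ p q : ℝ,
      ∫⁻ t : ℝ, ENNReal.ofReal (jb (t - p) ^ (-A) * jb (t - q) ^ (-B)) ≤
        C * ENNReal.ofReal (jb (p - q) ^ (-ρ)) := by
  set I := ∫⁻ t : ℝ, ENNReal.ofReal (jb t ^ (-(A + B - ρ))) with hI
  have hIt : I ≠ ⊤ := lintegral_jb_sub_ne_top h
  refine ⟨ENNReal.ofReal (2 ^ ρ) * (I + I), ENNReal.mul_ne_top ENNReal.ofReal_ne_top (by simp [hIt]),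
    fun p q => ?_⟩
  have hm : ∀ c : ℝ, Measurable fun t : ℝ => ENNReal.ofReal (jb (t - c) ^ (-(A + B - ρ))) :=
    fun c => ((measurable_jb.comp (measurable_id.sub_const c)).pow_const _).ennreal_ofReal
  have htr : ∀ c : ℝ, ∫⁻ t : ℝ, ENNReal.ofReal (jb (t - c) ^ (-(A + B - ρ))) = I := fun c =>
    lintegral_sub_right_eq_self (fun t : ℝ => ENNReal.ofReal (jb t ^ (-(A + B - ρ)))) c
  calc _ ≤ ∫⁻ t : ℝ, ENNReal.ofReal (2 ^ ρ * jb (p - q) ^ (-ρ)) *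
          (ENNReal.ofReal (jb (t - p) ^ (-(A + B - ρ))) +
            ENNReal.ofReal (jb (t - q) ^ (-(A + B - ρ)))) := by
        refine lintegral_mono fun t => ?_
        have hp := jb_pos (t - p)
        have hq := jb_pos (t - q)
        have hpq := jb_pos (p - q)
        rw [← ENNReal.ofReal_add (by positivity) (by positivity),
          ← ENNReal.ofReal_mul (by positivity)]
        refine ENNReal.ofReal_le_ofReal ?_
        have := jb_rpow_mul_jb_rpow_le (x := t - p) (y := t - q) hρ hA hB
        rwa [sub_sub_sub_cancel_left, ← neg_sub p q, jb_neg] at this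
    _ = _ := by
        have hpq := jb_pos (p - q)
        rw [lintegral_const_mul _ ((hm p).fun_add (hm q)), lintegral_add_left (hm p), htr, htr,
          ENNReal.ofReal_mul (by positivity)]
        ring

theorem mul_eq_four_mul_sq_of_sq_add_sq_eq {m x y u₁ u₂ v₁ v₂ A B : ℤ} (hm : 0 < m)
    (h : x ^ 2 + y ^ 2 = m) (hA : A = u₁ ^ 2 + u₂ ^ 2) (hB : B = v₁ ^ 2 + v₂ ^ 2)
    (hAp : A = -2 * (x * u₁ + y * u₂)) (hBq : B = -2 * (x * v₁ + y * v₂)) :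
    A * B * ((v₁ - u₁) ^ 2 + (v₂ - u₂) ^ 2) = 4 * m * (u₁ * v₂ - v₁ * u₂) ^ 2 := by
  have e1 : (B * u₁ - A * v₁) ^ 2 + (B * u₂ - A * v₂) ^ 2 =
      A * B * ((v₁ - u₁) ^ 2 + (v₂ - u₂) ^ 2) := by
    rw [hA, hB]; ring
  have e2 : x * (B * u₁ - A * v₁) + y * (B * u₂ - A * v₂) = 0 := by
    rw [hAp, hBq]; ring
  have e3 : x * (B * u₂ - A * v₂) - y * (B * u₁ - A * v₁) =
      2 * m * (u₁ * v₂ - v₁ * u₂) := by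
    rw [hAp, hBq, ← h]; ring
  refine mul_left_cancel₀ hm.ne' ?_
  rw [← e1]
  calc m * ((B * u₁ - A * v₁) ^ 2 + (B * u₂ - A * v₂) ^ 2)
      = (x * (B * u₁ - A * v₁) + y * (B * u₂ - A * v₂)) ^ 2 +
        (x * (B * u₂ - A * v₂) - y * (B * u₁ - A * v₁)) ^ 2 := by rw [← h]; ring
    _ = _ := by rw [e2, e3]; ring

theorem four_mul_le_of_sq_add_sq_eq {m X₁ Y₁ X₂ Y₂ X₃ Y₃ : ℤ} (hm : 0 < m)
    (h₁ : X₁ ^ 2 + Y₁ ^ 2 = m) (h₂ : X₂ ^ 2 + Y₂ ^ 2 = m) (h₃ : X₃ ^ 2 + Y₃ ^ 2 = m)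
    (h₁₂ : X₁ ≠ X₂) (h₁₃ : X₁ ≠ X₃) (h₂₃ : X₂ ≠ X₃) :
    4 * m ≤ ((X₂ - X₁) ^ 2 + (Y₂ - Y₁) ^ 2) * ((X₃ - X₁) ^ 2 + (Y₃ - Y₁) ^ 2) *
      ((X₃ - X₂) ^ 2 + (Y₃ - Y₂) ^ 2) := by
  have e := mul_eq_four_mul_sq_of_sq_add_sq_eq (u₁ := X₂ - X₁) (u₂ := Y₂ - Y₁) (v₁ := X₃ - X₁)
    (v₂ := Y₃ - Y₁) hm h₁ rfl rfl (by linear_combination h₂ - h₁) (by linear_combination h₃ - h₁)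
  rw [sub_sub_sub_cancel_right, sub_sub_sub_cancel_right] at e
  have hpos : ∀ {x y z w : ℤ}, x ≠ y → 0 < (y - x) ^ 2 + (z - w) ^ 2 := fun {x y z w} h => by
    have : 0 < (y - x) ^ 2 := by have := sub_ne_zero.2 h.symm; positivity
    positivity
  have h0 := mul_pos (mul_pos (hpos h₁₂ (z := Y₂) (w := Y₁)) (hpos h₁₃ (z := Y₃) (w := Y₁)))
    (hpos h₂₃ (z := Y₃) (w := Y₂))
  rw [e] at h0 ⊢
  have hd2 := pos_of_mul_pos_right h0 (by positivity)
  exact le_mul_of_one_le_right (by positivity) hd2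

theorem sq_sub_le_of_sq_add_sq_eq {m X₁ Y₁ X₂ Y₂ : ℝ} (hm : 0 < m)
    (h₁ : X₁ ^ 2 + Y₁ ^ 2 = m) (h₂ : X₂ ^ 2 + Y₂ ^ 2 = m) (hX₁ : |X₁| ≤ Y₁) (hX₂ : |X₂| ≤ Y₂) :
    (Y₂ - Y₁) ^ 2 ≤ (X₂ - X₁) ^ 2 := by
  have hY : ∀ {X Y : ℝ}, X ^ 2 + Y ^ 2 = m → |X| ≤ Y → 0 < Y := fun {X Y} h hX => by
    rcases (abs_nonneg X).trans hX |>.eq_or_lt with h0 | h0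
    · rw [← h0, abs_nonpos_iff] at hX
      rw [← h0, hX] at h
      norm_num at h
      linarith
    · exact h0
  have hY₁ := hY h₁ hX₁
  have hY₂ := hY h₂ hX₂
  have e : (Y₂ - Y₁) * (Y₂ + Y₁) = -((X₂ - X₁) * (X₂ + X₁)) := by linear_combination h₂ - h₁
  have hs : (X₂ + X₁) ^ 2 ≤ (Y₂ + Y₁) ^ 2 :=
    sq_le_sq.2 ((abs_add_le _ _).trans ((add_le_add hX₂ hX₁).trans (le_abs_self _)))
  have h2 : (Y₂ - Y₁) ^ 2 * (Y₂ + Y₁) ^ 2 ≤ (X₂ - X₁) ^ 2 * (Y₂ + Y₁) ^ 2 := by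
    calc _ = (X₂ - X₁) ^ 2 * (X₂ + X₁) ^ 2 := by rw [← mul_pow, e]; ring
      _ ≤ _ := by gcongr
  exact le_of_mul_le_mul_right h2 (by positivity)

theorem card_Icc_floor_le {u v : ℝ} (h : u ≤ v) :
    ((Finset.Icc ⌊u⌋ ⌊v⌋).card : ℝ) ≤ v - u + 2 := by
  have h1 : (⌊u⌋ : ℤ) ≤ ⌊v⌋ := Int.floor_mono h
  have : ((Finset.Icc ⌊u⌋ ⌊v⌋).card : ℤ) = ⌊v⌋ + 1 - ⌊u⌋ := by
    rw [Int.card_Icc, Int.toNat_of_nonneg (by omega)]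
  have h2 : ((Finset.Icc ⌊u⌋ ⌊v⌋).card : ℝ) = ⌊v⌋ + 1 - ⌊u⌋ := by exact_mod_cast this
  rw [h2]
  linarith [Int.floor_le v, Int.lt_floor_add_one u]

theorem card_floor_fiber_le_two {c m : ℤ} {ρ : ℝ} (hρ : 0 < ρ) (hm : (m : ℝ) = ρ ^ 6)
    (T : Finset (ℤ × ℤ)) (hT : ∀ p ∈ T, (2 * p.1 - c) ^ 2 + p.2 ^ 2 = m ∧ |2 * p.1 - c| ≤ p.2)
    (j : ℤ) : (T.filter fun p => ⌊(p.1 : ℝ) / (ρ / 3)⌋ = j).card ≤ 2 := by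
  by_contra! hcard
  obtain ⟨p, hp, q, hq, r, hr, hpq, hpr, hqr⟩ := Finset.two_lt_card.1 hcard
  rw [Finset.mem_filter] at hp hq hr
  have hm0 : (0 : ℝ) < m := by rw [hm]; positivity
  have hm0' : 0 < m := by exact_mod_cast hm0
  have hfst : ∀ p ∈ T, ∀ q ∈ T, p ≠ q → 2 * p.1 - c ≠ 2 * q.1 - c := by
    intro p hp q hq hne h
    have h1 := (hT p hp).1
    have h2 := (hT q hq).1
    have h3 := (abs_nonneg _).trans (hT p hp).2
    have h4 := (abs_nonneg _).trans (hT q hq).2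
    refine hne (Prod.ext (by omega) ?_)
    rw [h] at h1
    exact (sq_eq_sq₀ h3 h4).1 (by linarith)
  have hdist : ∀ p ∈ T, ∀ q ∈ T, ⌊(p.1 : ℝ) / (ρ / 3)⌋ = j → ⌊(q.1 : ℝ) / (ρ / 3)⌋ = j →
      (((2 * q.1 - c) - (2 * p.1 - c) : ℤ) : ℝ) ^ 2 + ((q.2 - p.2 : ℤ) : ℝ) ^ 2 ≤ 8 / 9 * ρ ^ 2 := by
    intro p hp q hq hpj hqj
    have h1 := Int.abs_sub_lt_one_of_floor_eq_floor (hqj.trans hpj.symm)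
    rw [← sub_div, abs_div, abs_of_pos (by positivity : 0 < ρ / 3), div_lt_one (by positivity)] at h1
    have h2 : ((q.1 : ℝ) - p.1) ^ 2 ≤ (ρ / 3) ^ 2 := sq_le_sq' (by linarith [(abs_lt.1 h1).1])
      (abs_lt.1 h1).2.le
    have h3 := sq_sub_le_of_sq_add_sq_eq (X₁ := 2 * p.1 - c) (Y₁ := p.2) (X₂ := 2 * q.1 - c)
      (Y₂ := q.2) hm0 (by exact_mod_cast (hT p hp).1) (by exact_mod_cast (hT q hq).1)
      (by exact_mod_cast (hT p hp).2) (by exact_mod_cast (hT q hq).2)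
    push_cast
    nlinarith
  have key := four_mul_le_of_sq_add_sq_eq hm0' (hT p hp.1).1 (hT q hq.1).1 (hT r hr.1).1
    (hfst p hp.1 q hq.1 hpq) (hfst p hp.1 r hr.1 hpr) (hfst q hq.1 r hr.1 hqr)
  have key' := (Int.cast_le (R := ℝ)).2 key
  simp only [Int.cast_mul, Int.cast_add, Int.cast_pow, Int.cast_ofNat] at key'
  have : (4 : ℝ) * m ≤ (8 / 9 * ρ ^ 2) * (8 / 9 * ρ ^ 2) * (8 / 9 * ρ ^ 2) := by
    refine key'.trans ?_
    gcongr
    · exact hdist p hp.1 q hq.1 hp.2 hq.2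
    · exact hdist p hp.1 r hr.1 hp.2 hr.2
    · exact hdist q hq.1 r hr.1 hq.2 hr.2
  rw [hm] at this
  have : 0 < ρ ^ 6 := by positivity
  nlinarith

theorem card_arc_le {c m : ℤ} {N : ℝ} (hN : 1 ≤ N) (T : Finset (ℤ × ℤ))
    (hT : ∀ p ∈ T, (2 * p.1 - c) ^ 2 + p.2 ^ 2 = m ∧ |2 * p.1 - c| ≤ p.2)
    (hTN : ∀ p ∈ T, |(p.1 : ℝ)| ≤ N) : (T.card : ℝ) ≤ 16 * N ^ (2 / 3 : ℝ) := by
  obtain ⟨n, hn, rfl⟩ : ∃ n : ℝ, 1 ≤ n ∧ N = n ^ 3 :=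
    ⟨N ^ (1 / 3 : ℝ), Real.one_le_rpow hN (by norm_num), by
      rw [← Real.rpow_natCast, ← Real.rpow_mul (by linarith)]; norm_num⟩
  have hn2 : (n ^ 3) ^ (2 / 3 : ℝ) = n ^ 2 := by
    rw [← Real.rpow_natCast, ← Real.rpow_mul (by linarith), ← Real.rpow_natCast]; norm_num
  rw [hn2]
  rcases le_or_gt m 0 with hm | hm
  · have : T.card ≤ 1 := Finset.card_le_one.2 fun p hp q hq => by
      have h1 := (hT p hp).1
      have h2 := (hT q hq).1
      have : ∀ {x y : ℤ}, x ^ 2 + y ^ 2 = m → x = 0 ∧ y = 0 := fun {x y} h => by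
        constructor <;> exact pow_eq_zero_iff two_ne_zero |>.1
          (by nlinarith [sq_nonneg x, sq_nonneg y])
      have h3 := this h1
      have h4 := this h2
      exact Prod.ext (by omega) (by omega)
    have : (T.card : ℝ) ≤ 1 := by exact_mod_cast this
    nlinarith
  have hm' : (0 : ℝ) < m := by exact_mod_cast hm
  obtain ⟨ρ, hρ, hmρ⟩ : ∃ ρ : ℝ, 0 < ρ ∧ (m : ℝ) = ρ ^ 6 :=
    ⟨(m : ℝ) ^ (1 / 6 : ℝ), by positivity, by
      rw [← Real.rpow_natCast, ← Real.rpow_mul hm'.le]; norm_num⟩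
  have hD : 0 < ρ / 3 := by positivity
  obtain ⟨u, v, huv, hmem, hlen⟩ : ∃ u v : ℝ, u ≤ v ∧ (∀ p ∈ T, u ≤ p.1 ∧ (p.1 : ℝ) ≤ v) ∧
      v / (ρ / 3) - u / (ρ / 3) ≤ 6 * n ^ 2 := by
    rcases le_total n ρ with h | h
    · refine ⟨-n ^ 3, n ^ 3, by nlinarith [pow_pos (zero_lt_one.trans_le hn) 3],
        fun p hp => abs_le.1 (hTN p hp), ?_⟩
      rw [← sub_div, div_le_iff₀ hD]
      nlinarith [mul_le_mul_of_nonneg_left h (sq_nonneg n)]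
    · refine ⟨((c : ℝ) - ρ ^ 3) / 2, (c + ρ ^ 3) / 2, by linarith [pow_pos hρ 3], fun p hp => ?_, ?_⟩
      · have h1 : (2 * (p.1 : ℝ) - c) ^ 2 + (p.2 : ℝ) ^ 2 = ρ ^ 6 := by
          rw [← hmρ]; exact_mod_cast (hT p hp).1
        have h2 : |2 * (p.1 : ℝ) - c| ≤ ρ ^ 3 :=
          abs_le_of_sq_le_sq (by nlinarith [sq_nonneg (p.2 : ℝ)]) (by positivity)
        rw [abs_le] at h2
        constructor <;> linarith
      · rw [← sub_div, div_le_iff₀ hD]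
        nlinarith [mul_le_mul h h hρ.le (by linarith : 0 ≤ n)]
  have himg : (T.image fun p => ⌊(p.1 : ℝ) / (ρ / 3)⌋) ⊆
      Finset.Icc ⌊u / (ρ / 3)⌋ ⌊v / (ρ / 3)⌋ := by
    intro j hj
    obtain ⟨p, hp, rfl⟩ := Finset.mem_image.1 hj
    obtain ⟨h1, h2⟩ := hmem p hp
    exact Finset.mem_Icc.2 ⟨Int.floor_mono (by gcongr), Int.floor_mono (by gcongr)⟩
  have hcard := Finset.card_le_mul_card_image (f := fun p : ℤ × ℤ => ⌊(p.1 : ℝ) / (ρ / 3)⌋) T 2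
    fun j _ => card_floor_fiber_le_two hρ hmρ T hT j
  have h3 : (T.card : ℝ) ≤ 2 * ((Finset.Icc ⌊u / (ρ / 3)⌋ ⌊v / (ρ / 3)⌋).card : ℝ) := by
    exact_mod_cast hcard.trans (Nat.mul_le_mul_left 2 (Finset.card_le_card himg))
  have h4 := card_Icc_floor_le (show u / (ρ / 3) ≤ v / (ρ / 3) by gcongr)
  nlinarith

theorem card_circle_le {a b m : ℤ} {N : ℝ} (hN : 1 ≤ N) (S : Finset (ℤ × ℤ))
    (hS : ∀ p ∈ S, (2 * p.1 - a) ^ 2 + (2 * p.2 - b) ^ 2 = m)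
    (hSN : ∀ p ∈ S, |(p.1 : ℝ)| ≤ N ∧ |(p.2 : ℝ)| ≤ N) :
    (S.card : ℝ) ≤ 64 * N ^ (2 / 3 : ℝ) := by
  have key : ∀ (c : ℤ) (P : ℤ × ℤ → Prop) [DecidablePred P] (f : ℤ × ℤ → ℤ × ℤ),
      Function.Injective f →
      (∀ p ∈ S, P p → (2 * (f p).1 - c) ^ 2 + (f p).2 ^ 2 = m ∧ |2 * (f p).1 - c| ≤ (f p).2 ∧
        |((f p).1 : ℝ)| ≤ N) → ((S.filter P).card : ℝ) ≤ 16 * N ^ (2 / 3 : ℝ) := by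
    intro c P _ f hf h
    rw [← Finset.card_image_of_injective _ hf]
    refine card_arc_le (c := c) (m := m) hN _ (fun q hq => ?_) fun q hq => ?_ <;>
    · obtain ⟨p, hp, rfl⟩ := Finset.mem_image.1 hq
      rw [Finset.mem_filter] at hp
      have := h p hp.1 hp.2
      tauto
  have k1 := key a (fun p => |2 * p.1 - a| ≤ 2 * p.2 - b) (fun p => (p.1, 2 * p.2 - b))
    (fun p q h => by simp only [Prod.mk.injEq] at h; exact Prod.ext (by omega) (by omega))
    fun p hp h => ⟨hS p hp, h, (hSN p hp).1⟩
  have k2 := key a (fun p => |2 * p.1 - a| ≤ b - 2 * p.2) (fun p => (p.1, b - 2 * p.2))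
    (fun p q h => by simp only [Prod.mk.injEq] at h; exact Prod.ext (by omega) (by omega))
    fun p hp h => ⟨by rw [← hS p hp]; ring, h, (hSN p hp).1⟩
  have k3 := key b (fun p => |2 * p.2 - b| ≤ 2 * p.1 - a) (fun p => (p.2, 2 * p.1 - a))
    (fun p q h => by simp only [Prod.mk.injEq] at h; exact Prod.ext (by omega) (by omega))
    fun p hp h => ⟨by rw [← hS p hp]; ring, h, (hSN p hp).2⟩
  have k4 := key b (fun p => |2 * p.2 - b| ≤ a - 2 * p.1) (fun p => (p.2, a - 2 * p.1))
    (fun p q h => by simp only [Prod.mk.injEq] at h; exact Prod.ext (by omega) (by omega))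
    fun p hp h => ⟨by rw [← hS p hp]; ring, h, (hSN p hp).2⟩
  have hcover : S ⊆ (S.filter (fun p => |2 * p.1 - a| ≤ 2 * p.2 - b) ∪
      S.filter (fun p => |2 * p.1 - a| ≤ b - 2 * p.2)) ∪
      (S.filter (fun p => |2 * p.2 - b| ≤ 2 * p.1 - a) ∪
      S.filter (fun p => |2 * p.2 - b| ≤ a - 2 * p.1)) := by
    intro p hp
    simp only [Finset.mem_union, Finset.mem_filter, hp, true_and, abs_le]
    omega
  have h5 : (S.card : ℝ) ≤ _ := Nat.cast_le.2 ((Finset.card_le_card hcover).trans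
    ((Finset.card_union_le _ _).trans
      (add_le_add (Finset.card_union_le _ _) (Finset.card_union_le _ _))))
  push_cast at h5
  linarith

/-- `⟨p⟩ = (1 + |p|²)^{1/2}` for `p ∈ ℤ × ℤ`. -/
noncomputable def jbp (p : ℤ × ℤ) : ℝ := Real.sqrt (1 + ((p.1 : ℝ) ^ 2 + (p.2 : ℝ) ^ 2))

theorem one_le_jbp (p : ℤ × ℤ) : 1 ≤ jbp p :=
  Real.one_le_sqrt.2 (by nlinarith [sq_nonneg (p.1 : ℝ), sq_nonneg (p.2 : ℝ)])

theorem jbp_pos (p : ℤ × ℤ) : 0 < jbp p := zero_lt_one.trans_le (one_le_jbp p)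

theorem jb_fst_le_jbp (p : ℤ × ℤ) : jb p.1 ≤ jbp p :=
  Real.sqrt_le_sqrt (by nlinarith [sq_nonneg (p.2 : ℝ)])

theorem jb_snd_le_jbp (p : ℤ × ℤ) : jb p.2 ≤ jbp p :=
  Real.sqrt_le_sqrt (by nlinarith [sq_nonneg (p.1 : ℝ)])

theorem ofReal_jbp_rpow_neg_le {e : ℝ} (he : 0 ≤ e) (p : ℤ × ℤ) :
    ENNReal.ofReal (jbp p ^ (-e)) ≤ ENNReal.ofReal (2 ^ e) *
      ∑' j : ℕ, if jbp p ≤ 2 ^ j then ENNReal.ofReal (((2 : ℝ) ^ j) ^ (-e)) else 0 := by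
  obtain ⟨j, hj, hj'⟩ := exists_nat_pow_near (one_le_jbp p) (one_lt_two : (1 : ℝ) < 2)
  refine le_trans ?_ (mul_le_mul_right (ENNReal.le_tsum (j + 1)) _)
  rw [if_pos hj'.le, ← ENNReal.ofReal_mul (by positivity)]
  refine ENNReal.ofReal_le_ofReal (rpow_neg_le_of_le_mul (by positivity) two_pos he ?_)
  rw [pow_succ']
  gcongr

theorem tsum_circle_indicator_le (a b m : ℤ) {N : ℝ} (hN : 1 ≤ N) :
    (∑' p : ℤ × ℤ, if (2 * p.1 - a) ^ 2 + (2 * p.2 - b) ^ 2 = m ∧ jbp p ≤ N then (1 : ENNReal)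
      else 0) ≤ ENNReal.ofReal (64 * N ^ (2 / 3 : ℝ)) := by
  rw [ENNReal.tsum_eq_iSup_sum]
  refine iSup_le fun s => ?_
  rw [Finset.sum_boole, ← ENNReal.ofReal_natCast]
  refine ENNReal.ofReal_le_ofReal (card_circle_le (a := a) (b := b) (m := m) hN _ (fun p hp => ?_) fun p hp => ?_)
  · exact (Finset.mem_filter.1 hp).2.1
  · have h := (Finset.mem_filter.1 hp).2.2
    exact ⟨(abs_le_jb _).trans ((jb_fst_le_jbp p).trans h),
      (abs_le_jb _).trans ((jb_snd_le_jbp p).trans h)⟩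

theorem exists_tsum_circle_le {e : ℝ} (he : 2 / 3 < e) :
    ∃ C : ENNReal, C ≠ ⊤ ∧ ∀ a b m : ℤ,
      (∑' p : ℤ × ℤ, if (2 * p.1 - a) ^ 2 + (2 * p.2 - b) ^ 2 = m then
        ENNReal.ofReal (jbp p ^ (-e)) else 0) ≤ C := by
  have hq : Summable fun j : ℕ => 64 * ((2 : ℝ) ^ (2 / 3 - e)) ^ j :=
    (summable_geometric_of_lt_one (by positivity)
      (Real.rpow_lt_one_of_one_lt_of_neg one_lt_two (by linarith))).mul_left 64
  refine ⟨ENNReal.ofReal (2 ^ e) * _, ENNReal.mul_ne_top ENNReal.ofReal_ne_top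
    hq.tsum_ofReal_ne_top, fun a b m => ?_⟩
  calc _ ≤ ∑' p : ℤ × ℤ, ENNReal.ofReal (2 ^ e) * ∑' j : ℕ,
          ENNReal.ofReal (((2 : ℝ) ^ j) ^ (-e)) *
            if (2 * p.1 - a) ^ 2 + (2 * p.2 - b) ^ 2 = m ∧ jbp p ≤ 2 ^ j then 1 else 0 := by
        refine ENNReal.tsum_le_tsum fun p => ?_
        split_ifs with h
        · refine (ofReal_jbp_rpow_neg_le (by linarith) p).trans_eq ?_
          congr 1
          refine tsum_congr fun j => ?_
          simp [h]
        · exact zero_le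
    _ = ENNReal.ofReal (2 ^ e) * ∑' j : ℕ, ENNReal.ofReal (((2 : ℝ) ^ j) ^ (-e)) *
          ∑' p : ℤ × ℤ, if (2 * p.1 - a) ^ 2 + (2 * p.2 - b) ^ 2 = m ∧ jbp p ≤ 2 ^ j then
            (1 : ENNReal) else 0 := by
        rw [ENNReal.tsum_mul_left, ENNReal.tsum_comm]
        simp only [ENNReal.tsum_mul_left]
    _ ≤ _ := by
        gcongr with j
        refine (mul_le_mul_right (tsum_circle_indicator_le a b m
          (one_le_pow₀ one_le_two)) _).trans_eq ?_
        rw [← ENNReal.ofReal_mul (by positivity)]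
        congr 1
        rw [mul_left_comm, ← Real.rpow_add (by positivity), ← Real.rpow_natCast,
          ← Real.rpow_natCast, ← Real.rpow_mul two_pos.le, ← Real.rpow_mul two_pos.le]
        ring_nf

theorem sq_abs_sub_sqrt_mul_abs_le (ν z : ℝ) : (|z| - √ν) ^ 2 * |ν| ≤ (ν - z ^ 2) ^ 2 := by
  rcases le_total 0 ν with h | h
  · have : (ν - z ^ 2) ^ 2 = (|z| - √ν) ^ 2 * (|z| + √ν) ^ 2 := by
      rw [← mul_pow, mul_comm, ← sq_sub_sq, Real.sq_sqrt h, sq_abs]; ring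
    rw [this, abs_of_nonneg h]
    gcongr
    nlinarith [Real.sq_sqrt h, Real.sqrt_nonneg ν, abs_nonneg z]
  · rw [Real.sqrt_eq_zero_of_nonpos h, sub_zero, sq_abs, abs_of_nonpos h]
    nlinarith [sq_nonneg z, mul_nonneg (sq_nonneg z) (neg_nonneg.2 h)]

theorem jb_pow_mul_jb_le {ν z : ℝ} (hd : 1 ≤ |(|z| - √ν)|) :
    jb (|z| - √ν) ^ 6 * jb ν ≤ 16 * jb (ν - z ^ 2) ^ 4 := by
  have hD : 1 ≤ (|z| - √ν) ^ 2 := by rw [← sq_abs]; nlinarith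
  have h1 := sq_abs_sub_sqrt_le ν z
  have h2 := sq_abs_sub_sqrt_mul_abs_le ν z
  have h3 := jb_sq (|z| - √ν)
  have h4 := jb_le_one_add_abs ν
  have h5 := abs_le_jb (ν - z ^ 2)
  have hν := abs_nonneg ν
  rw [← sq_abs (ν - z ^ 2)] at h2
  generalize (|z| - √ν) ^ 2 = D at *
  generalize |ν - z ^ 2| = u at *
  have hu : 0 ≤ u := by linarith
  have hDu : D ^ 2 ≤ u ^ 2 := by gcongr
  calc jb (|z| - √ν) ^ 6 * jb ν = (jb (|z| - √ν) ^ 2) ^ 3 * jb ν := by ring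
    _ ≤ (2 * D) ^ 3 * (1 + |ν|) := by
        rw [h3]
        have := jb_pos ν
        gcongr
        linarith
    _ = 8 * (D ^ 2 * D + D ^ 2 * (D * |ν|)) := by ring
    _ ≤ 8 * (u ^ 2 * u ^ 2 + u ^ 2 * u ^ 2) := by
        gcongr
        nlinarith
    _ = 16 * u ^ 4 := by ring
    _ ≤ _ := by gcongr

theorem jb_sub_sq_rpow_le {ν z X : ℝ} (hX : 1 ≤ X) (h : X ≤ jb (ν - z ^ 2) ^ 3) :
    jb (ν - z ^ 2) ^ (-(3 / 4) : ℝ) ≤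
      4 * (jb (|z| - √ν) ^ (-(9 / 8) : ℝ) * (X ^ (-(1 / 4) : ℝ) + jb ν ^ (-(3 / 16) : ℝ))) := by
  have hJ := jb_pos (ν - z ^ 2)
  have hd := jb_pos (|z| - √ν)
  have hν := jb_pos ν
  have hX0 : 0 < X := by linarith
  rcases le_or_gt 1 |(|z| - √ν)| with h1 | h1
  · have := rpow_neg_le_of_le_mul (by positivity) (by norm_num) (by norm_num : (0 : ℝ) ≤ 3 / 16)
      (jb_pow_mul_jb_le h1)
    rw [Real.mul_rpow (by positivity) hν.le, ← Real.rpow_natCast (jb (|z| - √ν)),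
      ← Real.rpow_natCast (jb (ν - z ^ 2)), ← Real.rpow_mul hJ.le, ← Real.rpow_mul hd.le] at this
    norm_num at this ⊢
    refine this.trans ?_
    have h16 : (16 : ℝ) ^ (3 / 16 : ℝ) ≤ 4 := by
      calc (16 : ℝ) ^ (3 / 16 : ℝ) ≤ 16 ^ (1 / 2 : ℝ) :=
            Real.rpow_le_rpow_of_exponent_le (by norm_num) (by norm_num)
        _ = 4 := by
          rw [show (16 : ℝ) = 4 ^ (2 : ℝ) by norm_num, ← Real.rpow_mul (by norm_num)]; norm_num
    gcongr
    exact le_add_of_nonneg_left (by positivity)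
  · have h2 : jb (|z| - √ν) ≤ 2 * 1 := by linarith [jb_le_one_add_abs (|z| - √ν)]
    have h3 := rpow_neg_le_of_le_mul hd two_pos (by norm_num : (0 : ℝ) ≤ 9 / 8) h2
    have h4 : (2 : ℝ) ^ (9 / 8 : ℝ) ≤ 4 := by
      calc (2 : ℝ) ^ (9 / 8 : ℝ) ≤ 2 ^ (2 : ℝ) :=
            Real.rpow_le_rpow_of_exponent_le (by norm_num) (by norm_num)
        _ = 4 := by norm_num
    have h5 := Real.rpow_le_rpow_of_nonpos hX0 h (by norm_num : (-(1 / 4) : ℝ) ≤ 0)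
    rw [← Real.rpow_natCast (jb _), ← Real.rpow_mul hJ.le] at h5
    rw [Real.one_rpow] at h3
    calc jb (ν - z ^ 2) ^ (-(3 / 4) : ℝ) ≤ X ^ (-(1 / 4) : ℝ) := by
          convert h5 using 2; norm_num
      _ ≤ (4 * jb (|z| - √ν) ^ (-(9 / 8) : ℝ)) * X ^ (-(1 / 4) : ℝ) := by
          refine le_mul_of_one_le_left (by positivity) (h3.trans ?_)
          gcongr
      _ ≤ _ := by
          rw [mul_assoc]
          gcongr
          exact le_add_of_nonneg_right (by positivity)

theorem rpow_neg_mul_rpow_neg_le {X V γ : ℝ} (hX : 1 ≤ X) (hV : 1 ≤ V) :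
    X ^ (-γ) * V ^ (-(3 / 16) : ℝ) ≤ X ^ (-(4 / 3 * γ)) + V ^ (-(3 / 4) : ℝ) := by
  have hX0 : 0 < X := by linarith
  have hV0 : 0 < V := by linarith
  have := Real.geom_mean_le_arith_mean2_weighted (w₁ := 3 / 4) (w₂ := 1 / 4)
    (p₁ := X ^ (-(4 / 3 * γ))) (p₂ := V ^ (-(3 / 4) : ℝ)) (by norm_num) (by norm_num)
    (by positivity) (by positivity) (by norm_num)
  rw [← Real.rpow_mul hX0.le, ← Real.rpow_mul hV0.le] at this
  have h1 : 0 < X ^ (-(4 / 3 * γ)) := by positivity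
  have h2 : 0 < V ^ (-(3 / 4) : ℝ) := by positivity
  calc _ = X ^ (-(4 / 3 * γ) * (3 / 4)) * V ^ (-(3 / 4) * (1 / 4) : ℝ) := by
        congr 2 <;> ring
    _ ≤ _ := this
    _ ≤ _ := by linarith

theorem jbp_rpow_mul_jb_rpow_le {γ δ : ℝ} (hδ : 0 ≤ δ) (hγ : δ ≤ γ) (p : ℤ × ℤ)
    {ν z : ℝ} :
    jbp p ^ (-γ) * jb (ν - z ^ 2) ^ (-(3 / 4) : ℝ) ≤
      jb (ν - z ^ 2) ^ (-(3 / 4 + 3 * (γ - δ))) * jbp p ^ (-δ) +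
      (jb p.1 ^ (-(γ + 1 / 4)) + jb p.1 ^ (-(4 / 3 * γ)) + jb ν ^ (-(3 / 4) : ℝ)) *
        (4 * jb (|z| - √ν) ^ (-(9 / 8) : ℝ)) := by
  have hJ := jb_pos (ν - z ^ 2)
  have hd := jb_pos (|z| - √ν)
  have hν := jb_pos ν
  have hX := jb_pos p.1
  have hK := jbp_pos p
  rcases le_total (jb (ν - z ^ 2) ^ 3) (jbp p) with h | h
  · refine le_trans ?_ (le_add_of_nonneg_right (by positivity))
    have h1 := Real.rpow_le_rpow_of_nonpos (by positivity) h (by linarith : -(γ - δ) ≤ 0)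
    rw [← Real.rpow_natCast (jb _), ← Real.rpow_mul hJ.le] at h1
    calc _ = jbp p ^ (-δ) * (jbp p ^ (-(γ - δ)) * jb (ν - z ^ 2) ^ (-(3 / 4) : ℝ)) := by
          rw [← mul_assoc, ← Real.rpow_add hK]; congr 2; ring
      _ ≤ jbp p ^ (-δ) * (jb (ν - z ^ 2) ^ (((3 : ℕ) : ℝ) * -(γ - δ)) *
          jb (ν - z ^ 2) ^ (-(3 / 4) : ℝ)) := by gcongr
      _ = _ := by
          rw [← Real.rpow_add hJ, mul_comm]; congr 2; push_cast; ring
  · refine le_trans ?_ (le_add_of_nonneg_left (by positivity))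
    have h1 := jb_sub_sq_rpow_le (one_le_jb p.1) ((jb_fst_le_jbp p).trans h)
    have h2 := Real.rpow_le_rpow_of_nonpos hX (jb_fst_le_jbp p) (by linarith : -γ ≤ 0)
    have h3 := rpow_neg_mul_rpow_neg_le (one_le_jb p.1) (one_le_jb ν) (γ := γ)
    calc _ ≤ jb p.1 ^ (-γ) * (4 * (jb (|z| - √ν) ^ (-(9 / 8) : ℝ) *
            (jb p.1 ^ (-(1 / 4) : ℝ) + jb ν ^ (-(3 / 16) : ℝ)))) := by gcongr
      _ = (jb p.1 ^ (-γ) * jb p.1 ^ (-(1 / 4) : ℝ) + jb p.1 ^ (-γ) * jb ν ^ (-(3 / 16) : ℝ)) *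
            (4 * jb (|z| - √ν) ^ (-(9 / 8) : ℝ)) := by ring
      _ ≤ _ := by
          refine mul_le_mul_of_nonneg_right ?_ (by positivity)
          rw [add_assoc]
          refine add_le_add (le_of_eq ?_) h3
          rw [← Real.rpow_add hX]; congr 1; ring

theorem two_mul_sub_injective (a : ℤ) : Function.Injective fun x : ℤ => 2 * x - a :=
  fun x y h => by simp only at h; omega

theorem exists_tsum_jb_circle_le {E δ : ℝ} (hE : 1 < E) (hδ : 2 / 3 < δ) :
    ∃ C : ENNReal, C ≠ ⊤ ∧ ∀ (a b : ℤ) (μ : ℝ),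
      ∑' p : ℤ × ℤ, ENNReal.ofReal (jb (μ - (2 * (p.1 : ℝ) - a) ^ 2 - (2 * (p.2 : ℝ) - b) ^ 2) ^ (-E) *
        jbp p ^ (-δ)) ≤ C := by
  obtain ⟨C₁, hC₁, h₁⟩ := exists_tsum_jb_int_sub_le hE
  obtain ⟨C₂, hC₂, h₂⟩ := exists_tsum_circle_le hδ
  refine ⟨C₁ * C₂, ENNReal.mul_ne_top hC₁ hC₂, fun a b μ => ?_⟩
  calc _ = ∑' (p : ℤ × ℤ) (m : ℤ), ENNReal.ofReal (jb (m - μ) ^ (-E)) *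
          if (2 * p.1 - a) ^ 2 + (2 * p.2 - b) ^ 2 = m then ENNReal.ofReal (jbp p ^ (-δ)) else 0 := by
        refine tsum_congr fun p => ?_
        rw [tsum_eq_single ((2 * p.1 - a) ^ 2 + (2 * p.2 - b) ^ 2)
          (fun m hm => by rw [if_neg hm.symm, mul_zero]), if_pos rfl,
          ENNReal.ofReal_mul (Real.rpow_nonneg (jb_pos _).le _), ← jb_neg]
        congr 4
        push_cast
        ring
    _ = ∑' m : ℤ, ENNReal.ofReal (jb (m - μ) ^ (-E)) * ∑' p : ℤ × ℤ,
          if (2 * p.1 - a) ^ 2 + (2 * p.2 - b) ^ 2 = m then ENNReal.ofReal (jbp p ^ (-δ)) else 0 := by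
        rw [ENNReal.tsum_comm]
        simp only [ENNReal.tsum_mul_left]
    _ ≤ ∑' m : ℤ, ENNReal.ofReal (jb (m - μ) ^ (-E)) * C₂ := by
        gcongr with m
        exact h₂ a b m
    _ ≤ C₁ * C₂ := by
        rw [ENNReal.tsum_mul_right]
        gcongr
        exact h₁ μ

theorem exists_tsum_jbp_mul_jb_le {γ : ℝ} (hγ : 3 / 4 < γ) :
    ∃ C : ENNReal, C ≠ ⊤ ∧ ∀ (a b : ℤ) (μ : ℝ),
      ∑' p : ℤ × ℤ, ENNReal.ofReal (jbp p ^ (-γ) *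
        jb (μ - (2 * (p.1 : ℝ) - a) ^ 2 - (2 * (p.2 : ℝ) - b) ^ 2) ^ (-(3 / 4) : ℝ)) ≤ C := by
  obtain ⟨δ, hδ, hδγ⟩ := exists_between (show 2 / 3 < γ - 1 / 12 by linarith)
  obtain ⟨C₀, hC₀, h₀⟩ := exists_tsum_jb_circle_le (E := 3 / 4 + 3 * (γ - δ)) (by linarith) hδ
  obtain ⟨C₁, hC₁, h₁⟩ := exists_tsum_jb_int_sub_le (e := γ + 1 / 4) (by linarith)
  obtain ⟨C₂, hC₂, h₂⟩ := exists_tsum_jb_int_sub_le (e := 4 / 3 * γ) (by linarith)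
  obtain ⟨C₃, hC₃, h₃⟩ := exists_tsum_jb_sub_sq_le (ρ := 3 / 4) (by norm_num)
  obtain ⟨C₄, hC₄, h₄⟩ := exists_tsum_jb_abs_sub_le (e := 9 / 8) (by norm_num)
  refine ⟨C₀ + (C₁ + C₂ + C₃) * (ENNReal.ofReal 4 * C₄), ENNReal.add_ne_top.2 ⟨hC₀,
    ENNReal.mul_ne_top (by simp [hC₁, hC₂, hC₃])
      (ENNReal.mul_ne_top ENNReal.ofReal_ne_top hC₄)⟩, fun a b μ => ?_⟩
  have hnn : ∀ x e : ℝ, 0 ≤ jb x ^ e := fun x e => Real.rpow_nonneg (jb_pos x).le e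
  set ν : ℤ → ℝ := fun x => μ - (2 * (x : ℝ) - a) ^ 2 with hν
  calc _ ≤ ∑' p : ℤ × ℤ, (ENNReal.ofReal (jb (ν p.1 - (2 * (p.2 : ℝ) - b) ^ 2) ^
            (-(3 / 4 + 3 * (γ - δ))) * jbp p ^ (-δ)) +
          (ENNReal.ofReal (jb p.1 ^ (-(γ + 1 / 4))) + ENNReal.ofReal (jb p.1 ^ (-(4 / 3 * γ))) +
            ENNReal.ofReal (jb (ν p.1) ^ (-(3 / 4) : ℝ))) * (ENNReal.ofReal 4 *
            ENNReal.ofReal (jb (|2 * (p.2 : ℝ) - b| - √(ν p.1)) ^ (-(9 / 8) : ℝ)))) := by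
        refine ENNReal.tsum_le_tsum fun p => ?_
        rw [← ENNReal.ofReal_mul (by norm_num), ← ENNReal.ofReal_add (hnn _ _) (hnn _ _),
          ← ENNReal.ofReal_add (add_nonneg (hnn _ _) (hnn _ _)) (hnn _ _),
          ← ENNReal.ofReal_mul (add_nonneg (add_nonneg (hnn _ _) (hnn _ _)) (hnn _ _)),
          ← ENNReal.ofReal_add (mul_nonneg (hnn _ _) (Real.rpow_nonneg (jbp_pos p).le _))
            (mul_nonneg (add_nonneg (add_nonneg (hnn _ _) (hnn _ _)) (hnn _ _))
              (mul_nonneg (by norm_num) (hnn _ _)))]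
        exact ENNReal.ofReal_le_ofReal
          (jbp_rpow_mul_jb_rpow_le (by linarith) (by linarith) p)
    _ ≤ _ := by
        rw [ENNReal.tsum_add, ENNReal.tsum_prod
          (f := fun x y => (ENNReal.ofReal (jb (x : ℤ) ^ (-(γ + 1 / 4))) +
            ENNReal.ofReal (jb x ^ (-(4 / 3 * γ))) + ENNReal.ofReal (jb (ν x) ^ (-(3 / 4) : ℝ))) *
            (ENNReal.ofReal 4 *
              ENNReal.ofReal (jb (|2 * ((y : ℤ) : ℝ) - b| - √(ν x)) ^ (-(9 / 8) : ℝ))))]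
        refine add_le_add (h₀ a b μ) ?_
        simp only [ENNReal.tsum_mul_left]
        calc _ ≤ ∑' x : ℤ, (ENNReal.ofReal (jb x ^ (-(γ + 1 / 4))) +
              ENNReal.ofReal (jb x ^ (-(4 / 3 * γ))) + ENNReal.ofReal (jb (ν x) ^ (-(3 / 4) : ℝ))) *
                (ENNReal.ofReal 4 * C₄) := by
              gcongr with x
              refine le_trans ?_ (h₄ (√(ν x)))
              have := ENNReal.tsum_comp_le_tsum_of_injective (two_mul_sub_injective b)
                fun z : ℤ => ENNReal.ofReal (jb (|(z : ℝ)| - √(ν x)) ^ (-(9 / 8) : ℝ))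
              simpa using this
          _ ≤ _ := by
              rw [ENNReal.tsum_mul_right, ENNReal.tsum_add, ENNReal.tsum_add]
              gcongr
              · simpa using h₁ 0
              · simpa using h₂ 0
              · refine le_trans ?_ (h₃ μ)
                have := ENNReal.tsum_comp_le_tsum_of_injective (two_mul_sub_injective a)
                  fun z : ℤ => ENNReal.ofReal (jb (μ - (z : ℝ) ^ 2) ^ (-(3 / 4) : ℝ))
                simpa [hν] using this

/-- The measure `Σ_k ∫ dτ` on `α × ℝ`. -/
noncomputable abbrev countVol (α : Type*) [MeasurableSpace α] : Measure (α × ℝ) :=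
  Measure.count.prod volume

theorem lintegral_countVol {α : Type*} [MeasurableSpace α] [Countable α]
    [MeasurableSingletonClass α] {f : α × ℝ → ENNReal} (hf : Measurable f) :
    ∫⁻ z, f z ∂countVol α = ∑' k, ∫⁻ τ, f (k, τ) := by
  rw [lintegral_prod _ hf.aemeasurable, lintegral_count]

theorem measurableSub₂_prod_real (α : Type*) [MeasurableSpace α] [Countable α]
    [MeasurableSingletonClass α] [AddCommGroup α] : MeasurableSub₂ (α × ℝ) := by
  have : MeasurableSub₂ α := ⟨Measurable.of_discrete⟩
  exact ⟨Measurable.prodMk (by fun_prop) (by fun_prop)⟩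

theorem lintegral_countVol_sub_left {α : Type*} [MeasurableSpace α] [Countable α]
    [MeasurableSingletonClass α] [AddCommGroup α] {f : α × ℝ → ENNReal} (hf : Measurable f)
    (z : α × ℝ) : ∫⁻ w, f (z - w) ∂countVol α = ∫⁻ w, f w ∂countVol α := by
  have := measurableSub₂_prod_real α
  rw [lintegral_countVol hf, lintegral_countVol (f := fun w => f (z - w)) (by fun_prop),
    ← (Equiv.subLeft z.1).tsum_eq fun k => ∫⁻ τ, f (k, τ)]
  exact tsum_congr fun k => lintegral_sub_left_eq_self (fun t => f (z.1 - k, t)) z.2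

theorem lintegral_countVol_sub_right {α : Type*} [MeasurableSpace α] [Countable α]
    [MeasurableSingletonClass α] [AddCommGroup α] {f : α × ℝ → ENNReal} (hf : Measurable f)
    (z : α × ℝ) : ∫⁻ w, f (w - z) ∂countVol α = ∫⁻ w, f w ∂countVol α := by
  have := measurableSub₂_prod_real α
  rw [lintegral_countVol hf, lintegral_countVol (f := fun w => f (w - z)) (by fun_prop),
    ← (Equiv.subRight z.1).tsum_eq fun k => ∫⁻ τ, f (k, τ)]
  exact tsum_congr fun k => lintegral_sub_right_eq_self (fun t => f (k - z.1, t)) z.2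

theorem lintegral_countVol_fin_two {f : (Fin 2 → ℤ) × ℝ → ENNReal} (hf : Measurable f) :
    ∫⁻ z, f z ∂countVol (Fin 2 → ℤ) = ∑' n : ℤ, ∫⁻ v, f (![n, v.1], v.2) ∂countVol ℤ := by
  rw [lintegral_countVol hf, ← (finTwoArrowEquiv ℤ).symm.tsum_eq, ENNReal.tsum_prod']
  refine tsum_congr fun n => (lintegral_countVol
    (f := fun v : ℤ × ℝ => f (![n, v.1], v.2)) ?_).symm
  exact hf.comp (by fun_prop)

theorem lintegral_sq_conv_le {α : Type*} [MeasurableSpace α] [Countable α]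
    [MeasurableSingletonClass α] [AddCommGroup α] {κ : α × ℝ → α × ℝ → ENNReal} {S : ENNReal}
    {F₁ F₂ : α × ℝ → ENNReal} (hκ : Measurable (Function.uncurry κ)) (h₁ : Measurable F₁)
    (h₂ : Measurable F₂) (hS : ∀ z, ∫⁻ w, κ z w ^ 2 ∂countVol α ≤ S) :
    ∫⁻ z, (∫⁻ w, κ z w * (F₁ w * F₂ (z - w)) ∂countVol α) ^ 2 ∂countVol α ≤
      S * ((∫⁻ z, F₁ z ^ 2 ∂countVol α) * ∫⁻ z, F₂ z ^ 2 ∂countVol α) := by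
  have := measurableSub₂_prod_real α
  have hm : Measurable fun p : (α × ℝ) × (α × ℝ) => (F₁ p.2 * F₂ (p.1 - p.2)) ^ 2 := by fun_prop
  calc _ ≤ ∫⁻ z, S * ∫⁻ w, (F₁ w * F₂ (z - w)) ^ 2 ∂countVol α ∂countVol α := by
        gcongr with z
        refine (sq_lintegral_mul_le _ (hκ.comp measurable_prodMk_left).aemeasurable
          (Measurable.aemeasurable (by fun_prop))).trans ?_
        gcongr
        exact hS z
    _ = S * ∫⁻ w, ∫⁻ z, (F₁ w * F₂ (z - w)) ^ 2 ∂countVol α ∂countVol α := by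
        rw [lintegral_const_mul _ hm.lintegral_prod_right', lintegral_lintegral_swap hm.aemeasurable]
    _ = _ := by
        congr 1
        simp only [mul_pow]
        rw [← lintegral_mul_const _ (by fun_prop)]
        refine lintegral_congr fun w => ?_
        rw [lintegral_const_mul _ (by fun_prop),
          lintegral_countVol_sub_right (f := fun z => F₂ z ^ 2) (by fun_prop)]

theorem lintegral_sq_conv_le_of_dominant {α : Type*} [MeasurableSpace α] [Countable α]
    [MeasurableSingletonClass α] [AddCommGroup α] {κ : α × ℝ → α × ℝ → ENNReal} {S : ENNReal}
    {F₁ F₂ : α × ℝ → ENNReal} (hκ : Measurable (Function.uncurry κ)) (h₁ : Measurable F₁)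
    (h₂ : Measurable F₂) (hS : ∀ w, ∫⁻ z, κ z w ^ 2 ∂countVol α ≤ S) :
    ∫⁻ z, (∫⁻ w, κ z w * (F₁ w * F₂ (z - w)) ∂countVol α) ^ 2 ∂countVol α ≤
      S * ((∫⁻ z, F₁ z ^ 2 ∂countVol α) * ∫⁻ z, F₂ z ^ 2 ∂countVol α) := by
  have := measurableSub₂_prod_real α
  refine lintegral_sq_lintegral_kernel_le _ _ h₁ hκ (Φ := fun z w => F₂ (z - w))
    (by unfold Function.uncurry; fun_prop) hS fun z => ?_
  rw [lintegral_countVol_sub_left (f := fun z => F₂ z ^ 2) (by fun_prop)]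

theorem lintegral_sq_conv_le_of_dominant' {α : Type*} [MeasurableSpace α] [Countable α]
    [MeasurableSingletonClass α] [AddCommGroup α] {κ : α × ℝ → α × ℝ → ENNReal} {S : ENNReal}
    {F₁ F₂ : α × ℝ → ENNReal} (hκ : Measurable (Function.uncurry κ)) (h₁ : Measurable F₁)
    (h₂ : Measurable F₂) (hS : ∀ w, ∫⁻ z, κ z w ^ 2 ∂countVol α ≤ S) :
    ∫⁻ z, (∫⁻ w, κ z (z - w) * (F₁ w * F₂ (z - w)) ∂countVol α) ^ 2 ∂countVol α ≤
      S * ((∫⁻ z, F₁ z ^ 2 ∂countVol α) * ∫⁻ z, F₂ z ^ 2 ∂countVol α) := by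
  have := measurableSub₂_prod_real α
  rw [mul_comm (∫⁻ z, F₁ z ^ 2 ∂_)]
  refine le_of_eq_of_le (lintegral_congr fun z => ?_)
    (lintegral_sq_conv_le_of_dominant hκ h₂ h₁ hS)
  rw [← lintegral_countVol_sub_left (f := fun w => κ z w * (F₂ w * F₁ (z - w)))
    ((hκ.comp measurable_prodMk_left).mul (by fun_prop)) z]
  simp only [sub_sub_cancel, mul_comm (F₁ _)]

theorem half_rpow_jb_le (u : ℝ) {e : ℝ} (he : 0 ≤ e) :
    jb (u / 2) ^ (-e) ≤ 2 ^ e * jb u ^ (-e) := by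
  refine rpow_neg_le_of_le_mul (jb_pos u) two_pos he ?_
  have h1 := jb_sq u
  have h2 := jb_sq (u / 2)
  have h3 := jb_pos (u / 2)
  refine le_of_sq_le_sq ?_ (by positivity)
  nlinarith

theorem exists_lintegral_jb_parabola_le {b : ℝ} (hb : 3 / 8 < b) (hb' : b < 1 / 2) :
    ∃ S : ENNReal, S ≠ ⊤ ∧ ∀ (c₁ c₂ : ℝ) (z : ℤ × ℝ),
      ∫⁻ w, ENNReal.ofReal (jb (w.2 - ((w.1 : ℝ) ^ 2 + c₁)) ^ (-b) *
        jb (z.2 - w.2 - (((z.1 - w.1 : ℤ) : ℝ) ^ 2 + c₂)) ^ (-b)) ^ 2 ∂countVol ℤ ≤ S := by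
  have hJ := measurable_jb
  obtain ⟨C, hC, h⟩ := exists_lintegral_jb_mul_jb_le (A := 2 * b) (B := 2 * b) (ρ := 2 * b - 1 / 4)
    (by linarith) (by linarith) (by linarith) (by linarith)
  obtain ⟨D, hD, h'⟩ := exists_tsum_jb_sub_sq_le (ρ := 2 * b - 1 / 4) (by linarith)
  refine ⟨C * (ENNReal.ofReal (2 ^ (2 * b - 1 / 4)) * D), by finiteness, fun c₁ c₂ z => ?_⟩
  rw [lintegral_countVol (by fun_prop)]
  calc _ = ∑' y : ℤ, ∫⁻ t, ENNReal.ofReal (jb (t - ((y : ℝ) ^ 2 + c₁)) ^ (-(2 * b)) *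
          jb (t - (z.2 - (((z.1 - y : ℤ) : ℝ) ^ 2 + c₂))) ^ (-(2 * b))) := by
        refine tsum_congr fun y => lintegral_congr fun t => ?_
        have h1 := jb_pos (t - ((y : ℝ) ^ 2 + c₁))
        have h2 := jb_pos (z.2 - t - (((z.1 - y : ℤ) : ℝ) ^ 2 + c₂))
        have h3 : jb (t - (z.2 - (((z.1 - y : ℤ) : ℝ) ^ 2 + c₂))) =
          jb (z.2 - t - (((z.1 - y : ℤ) : ℝ) ^ 2 + c₂)) := by rw [← jb_neg]; congr 1; ring
        rw [h3, ← ENNReal.ofReal_pow (by positivity), mul_pow, ← Real.rpow_mul_natCast h1.le,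
          ← Real.rpow_mul_natCast h2.le]
        congr 3 <;> push_cast <;> ring
    _ ≤ ∑' y : ℤ, C * (ENNReal.ofReal (2 ^ (2 * b - 1 / 4)) * ENNReal.ofReal
          (jb ((2 * (z.2 - c₁ - c₂) - z.1 ^ 2) - ((2 * y - z.1 : ℤ) : ℝ) ^ 2) ^
            (-(2 * b - 1 / 4)))) := by
        refine ENNReal.tsum_le_tsum fun y => (h _ _).trans ?_
        gcongr
        rw [← ENNReal.ofReal_mul (by positivity)]
        refine ENNReal.ofReal_le_ofReal (le_of_eq_of_le ?_ (half_rpow_jb_le _ (by linarith)))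
        rw [← jb_neg]
        congr 2
        push_cast
        ring
    _ ≤ _ := by
        rw [ENNReal.tsum_mul_left, ENNReal.tsum_mul_left]
        gcongr
        exact (ENNReal.tsum_comp_le_tsum_of_injective (two_mul_sub_injective z.1)
          fun u : ℤ => ENNReal.ofReal (jb ((2 * (z.2 - c₁ - c₂) - z.1 ^ 2) - (u : ℝ) ^ 2) ^
            (-(2 * b - 1 / 4)))).trans (h' _)

theorem measurable_zn2 : Measurable zn2 := Measurable.of_discrete

theorem measurable_jbk : Measurable jbk := Measurable.of_discrete

theorem zn2_vec (x y : ℤ) : zn2 ![x, y] = (x : ℝ) ^ 2 + (y : ℝ) ^ 2 := by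
  simp [zn2, Fin.sum_univ_two]

theorem zn2_nonneg (k : Fin 2 → ℤ) : 0 ≤ zn2 k := Finset.sum_nonneg fun _ _ => sq_nonneg _

theorem jbk_sq (k : Fin 2 → ℤ) : jbk k ^ 2 = 1 + zn2 k :=
  Real.sq_sqrt (by linarith [zn2_nonneg k])

theorem one_le_jbk (k : Fin 2 → ℤ) : 1 ≤ jbk k :=
  Real.one_le_sqrt.2 (by linarith [zn2_nonneg k])

theorem jbk_pos (k : Fin 2 → ℤ) : 0 < jbk k := zero_lt_one.trans_le (one_le_jbk k)

theorem jb_le_jbk_vec (x y : ℤ) : jb x ≤ jbk ![x, y] := by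
  unfold jb jbk
  rw [zn2_vec]
  exact Real.sqrt_le_sqrt (by nlinarith [sq_nonneg (y : ℝ)])

theorem lintegral_sq_row_le {b : ℝ} {S : ENNReal}
    (hS : ∀ (c₁ c₂ : ℝ) (z : ℤ × ℝ),
      ∫⁻ w, ENNReal.ofReal (jb (w.2 - ((w.1 : ℝ) ^ 2 + c₁)) ^ (-b) *
        jb (z.2 - w.2 - (((z.1 - w.1 : ℤ) : ℝ) ^ 2 + c₂)) ^ (-b)) ^ 2 ∂countVol ℤ ≤ S)
    {F₁ F₂ : (Fin 2 → ℤ) × ℝ → ENNReal} (h₁ : Measurable F₁) (h₂ : Measurable F₂) (n : ℤ) :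
    ∫⁻ v, (∫⁻ w, ENNReal.ofReal (jb (w.2 - zn2 w.1) ^ (-b) *
        jb (v.2 - w.2 - zn2 (![n, v.1] - w.1)) ^ (-b)) *
        (F₁ w * F₂ ((![n, v.1], v.2) - w)) ∂countVol (Fin 2 → ℤ)) ^ 2 ∂countVol ℤ ≤
      S * ((∫⁻ z, F₁ z ^ 2 ∂countVol (Fin 2 → ℤ)) * ∫⁻ z, F₂ z ^ 2 ∂countVol (Fin 2 → ℤ)) := by
  have hJ := measurable_jb
  have hz := measurable_zn2
  have := measurableSub₂_prod_real ℤ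
  set Φ₁ : ℤ → ℤ × ℝ → ENNReal := fun x u => F₁ (![x, u.1], u.2) with hΦ₁
  set Φ₂ : ℤ → ℤ × ℝ → ENNReal := fun x u => F₂ (![x, u.1], u.2) with hΦ₂
  have m₁ : ∀ x, Measurable (Φ₁ x) := fun x => h₁.comp (by fun_prop)
  have m₂ : ∀ x, Measurable (Φ₂ x) := fun x => h₂.comp (by fun_prop)
  set κ : ℤ → ℤ × ℝ → ℤ × ℝ → ENNReal := fun x v u =>
    ENNReal.ofReal (jb (u.2 - ((u.1 : ℝ) ^ 2 + (x : ℝ) ^ 2)) ^ (-b) *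
      jb (v.2 - u.2 - (((v.1 - u.1 : ℤ) : ℝ) ^ 2 + ((n - x : ℤ) : ℝ) ^ 2)) ^ (-b)) with hκ
  have mκ : ∀ x, Measurable (Function.uncurry (κ x)) := fun x => by
    simp only [hκ, Function.uncurry_def]; fun_prop
  calc _ = ∫⁻ v, (∑' x, ∫⁻ u, κ x v u * (Φ₁ x u * Φ₂ (n - x) (v - u)) ∂countVol ℤ) ^ 2
          ∂countVol ℤ := by
        refine lintegral_congr fun v => ?_
        rw [lintegral_countVol_fin_two (by fun_prop)]
        congr 1
        refine tsum_congr fun x => lintegral_congr fun u => ?_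
        have h : ![n, v.1] - ![x, u.1] = ![n - x, v.1 - u.1] := by simp
        simp only [hκ, hΦ₁, hΦ₂, Prod.mk_sub_mk, h, zn2_vec, add_comm, Prod.fst_sub, Prod.snd_sub]
    _ ≤ (∑' x, (∫⁻ v, (∫⁻ u, κ x v u * (Φ₁ x u * Φ₂ (n - x) (v - u)) ∂countVol ℤ) ^ 2
          ∂countVol ℤ) ^ (1 / 2 : ℝ)) ^ 2 := by
        refine lintegral_sq_tsum_le _ fun x => ?_
        have : Measurable fun p : (ℤ × ℝ) × (ℤ × ℝ) =>
            κ x p.1 p.2 * (Φ₁ x p.2 * Φ₂ (n - x) (p.1 - p.2)) :=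
          (mκ x).mul (by fun_prop)
        exact this.lintegral_prod_right'
    _ ≤ (∑' x, (S ^ (1 / 2 : ℝ) * (∫⁻ u, Φ₁ x u ^ 2 ∂countVol ℤ) ^ (1 / 2 : ℝ)) *
          (∫⁻ u, Φ₂ (n - x) u ^ 2 ∂countVol ℤ) ^ (1 / 2 : ℝ)) ^ 2 := by
        gcongr with x
        rw [← ENNReal.mul_rpow_of_nonneg _ _ (by norm_num),
          ← ENNReal.mul_rpow_of_nonneg _ _ (by norm_num), mul_assoc]
        gcongr
        exact lintegral_sq_conv_le (mκ x) (m₁ x) (m₂ _) fun v => hS _ _ v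
    _ ≤ (∑' x, S * ∫⁻ u, Φ₁ x u ^ 2 ∂countVol ℤ) *
          ∑' x, ∫⁻ u, Φ₂ (n - x) u ^ 2 ∂countVol ℤ := by
        have hsq : ∀ a : ENNReal, (a ^ (1 / 2 : ℝ)) ^ 2 = a := fun a => by
          rw [← ENNReal.rpow_two, ← ENNReal.rpow_mul]; norm_num
        refine (sq_tsum_mul_le _ _).trans_eq ?_
        simp only [mul_pow, hsq]
    _ = _ := by
        rw [ENNReal.tsum_mul_left, mul_assoc, lintegral_countVol_fin_two (by fun_prop),
          lintegral_countVol_fin_two (by fun_prop),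
          ← (Equiv.subLeft n).tsum_eq fun x => ∫⁻ u, F₂ (![x, u.1], u.2) ^ 2 ∂countVol ℤ]
        rfl

theorem exists_lintegral_sq_conv_output_le {b η : ℝ} (hb : 3 / 8 < b) (hb' : b < 1 / 2)
    (hη : 1 / 2 < η) :
    ∃ C : ENNReal, C ≠ ⊤ ∧ ∀ F₁ F₂ : (Fin 2 → ℤ) × ℝ → ENNReal, Measurable F₁ → Measurable F₂ →
      ∫⁻ z, (∫⁻ w, ENNReal.ofReal (jbk z.1 ^ (-η) * (jb (w.2 - zn2 w.1) ^ (-b) *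
        jb (z.2 - w.2 - zn2 (z.1 - w.1)) ^ (-b))) * (F₁ w * F₂ (z - w))
          ∂countVol (Fin 2 → ℤ)) ^ 2 ∂countVol (Fin 2 → ℤ) ≤
      C * ((∫⁻ z, F₁ z ^ 2 ∂countVol (Fin 2 → ℤ)) *
        ∫⁻ z, F₂ z ^ 2 ∂countVol (Fin 2 → ℤ)) := by
  obtain ⟨S, hS, h⟩ := exists_lintegral_jb_parabola_le hb hb'
  obtain ⟨C, hC, hsum⟩ := exists_tsum_jb_int_sub_le (e := 2 * η) (by linarith)
  refine ⟨C * S, ENNReal.mul_ne_top hC hS, fun F₁ F₂ h₁ h₂ => ?_⟩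
  have hJ := measurable_jb
  have hz := measurable_zn2
  have hK := measurable_jbk
  have mG : Measurable fun p : ((Fin 2 → ℤ) × ℝ) × ((Fin 2 → ℤ) × ℝ) =>
      ENNReal.ofReal (jb (p.2.2 - zn2 p.2.1) ^ (-b) *
        jb (p.1.2 - p.2.2 - zn2 (p.1.1 - p.2.1)) ^ (-b)) * (F₁ p.2 * F₂ (p.1 - p.2)) := by fun_prop
  have mG' := mG.lintegral_prod_right' (ν := countVol (Fin 2 → ℤ))
  calc _ = ∫⁻ z, ENNReal.ofReal (jbk z.1 ^ (-η)) ^ 2 * (∫⁻ w, ENNReal.ofReal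
          (jb (w.2 - zn2 w.1) ^ (-b) * jb (z.2 - w.2 - zn2 (z.1 - w.1)) ^ (-b)) *
          (F₁ w * F₂ (z - w)) ∂countVol (Fin 2 → ℤ)) ^ 2 ∂countVol (Fin 2 → ℤ) := by
        refine lintegral_congr fun z => ?_
        rw [← mul_pow, ← lintegral_const_mul _ (by fun_prop)]
        simp only [ENNReal.ofReal_mul (Real.rpow_nonneg (jbk_pos z.1).le (-η)), mul_assoc]
    _ ≤ ∑' n : ℤ, ENNReal.ofReal (jb n ^ (-(2 * η))) * (S * ((∫⁻ z, F₁ z ^ 2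
          ∂countVol (Fin 2 → ℤ)) * ∫⁻ z, F₂ z ^ 2 ∂countVol (Fin 2 → ℤ))) := by
        rw [lintegral_countVol_fin_two (by fun_prop)]
        refine ENNReal.tsum_le_tsum fun n => ?_
        refine le_trans ?_ (mul_le_mul_right (lintegral_sq_row_le h h₁ h₂ n) _)
        rw [← lintegral_const_mul]
        · refine lintegral_mono fun v => ?_
          refine mul_le_mul_left ?_ _
          rw [← ENNReal.ofReal_pow (Real.rpow_nonneg (jbk_pos _).le _)]
          refine ENNReal.ofReal_le_ofReal ?_
          rw [← Real.rpow_mul_natCast (jbk_pos _).le]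
          convert Real.rpow_le_rpow_of_nonpos (jb_pos _) (jb_le_jbk_vec n v.1)
            (by linarith : -(2 * η) ≤ 0) using 2
          push_cast; ring
        · exact (mG'.comp (f := fun v : ℤ × ℝ => (![n, v.1], v.2)) (by fun_prop)).pow_const 2
    _ ≤ _ := by
        rw [ENNReal.tsum_mul_right, mul_assoc C]
        gcongr
        simpa using hsum 0

theorem exists_lintegral_input_kernel_le {b β η : ℝ} (hb : 3 / 8 < b) (hβ : 3 / 8 < β)
    (hbβ : 7 / 8 < β + b) (hη : 3 / 8 < η) :
    ∃ S : ENNReal, S ≠ ⊤ ∧ ∀ w : (Fin 2 → ℤ) × ℝ,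
      ∫⁻ z, ENNReal.ofReal (jbk z.1 ^ (-η) * (jb (z.2 + zn2 z.1) ^ (-β) *
        jb (z.2 - w.2 - zn2 (z.1 - w.1)) ^ (-b))) ^ 2 ∂countVol (Fin 2 → ℤ) ≤ S := by
  obtain ⟨C, hC, h⟩ := exists_lintegral_jb_mul_jb_le (A := 2 * β) (B := 2 * b) (ρ := 3 / 4)
    (by norm_num) (by linarith) (by linarith) (by linarith)
  obtain ⟨D, hD, h'⟩ := exists_tsum_jbp_mul_jb_le (γ := 2 * η) (by linarith)
  refine ⟨C * (ENNReal.ofReal (2 ^ (3 / 4 : ℝ)) * D), by finiteness, fun w => ?_⟩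
  have hJ := measurable_jb
  have hz := measurable_zn2
  have hK := measurable_jbk
  rw [lintegral_countVol (by fun_prop)]
  calc _ = ∑' k, ENNReal.ofReal (jbk k ^ (-(2 * η))) * ∫⁻ t, ENNReal.ofReal
          (jb (t - -zn2 k) ^ (-(2 * β)) * jb (t - (w.2 + zn2 (k - w.1))) ^ (-(2 * b))) := by
        refine tsum_congr fun k => ?_
        rw [← lintegral_const_mul _ (by fun_prop)]
        refine lintegral_congr fun t => ?_
        have h0 := jbk_pos k
        have h1 := jb_pos (t + zn2 k)
        have h2 := jb_pos (t - w.2 - zn2 (k - w.1))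
        rw [sub_neg_eq_add, ← sub_sub, ← ENNReal.ofReal_mul (by positivity),
          ← ENNReal.ofReal_pow (by positivity), mul_pow, mul_pow, ← Real.rpow_mul_natCast h1.le,
          ← Real.rpow_mul_natCast h2.le, ← Real.rpow_mul_natCast h0.le]
        congr 3
        · push_cast; ring
        · congr 1; push_cast; ring
        · congr 1; push_cast; ring
    _ ≤ ∑' k, C * (ENNReal.ofReal (2 ^ (3 / 4 : ℝ)) * ENNReal.ofReal (jbk k ^ (-(2 * η)) *
          jb (-(2 * w.2 + zn2 w.1) - (2 * (k 0 : ℝ) - w.1 0) ^ 2 - (2 * (k 1 : ℝ) - w.1 1) ^ 2) ^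
            (-(3 / 4) : ℝ))) := by
        refine ENNReal.tsum_le_tsum fun k => ?_
        have h0 := jbk_pos k
        rw [ENNReal.ofReal_mul (by positivity)]
        rw [mul_left_comm (ENNReal.ofReal (2 ^ (3 / 4 : ℝ))), mul_left_comm C]
        gcongr
        refine (h _ _).trans ?_
        gcongr
        rw [← ENNReal.ofReal_mul (by positivity)]
        refine ENNReal.ofReal_le_ofReal (le_of_eq_of_le ?_ (half_rpow_jb_le _ (by norm_num)))
        congr 2
        simp only [zn2, Fin.sum_univ_two, Pi.sub_apply]
        push_cast
        ring
    _ ≤ _ := by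
        rw [ENNReal.tsum_mul_left, ENNReal.tsum_mul_left, ← (finTwoArrowEquiv ℤ).symm.tsum_eq]
        gcongr
        refine le_of_eq_of_le (tsum_congr fun p => ?_) (h' (w.1 0) (w.1 1) (-(2 * w.2 + zn2 w.1)))
        simp [jbk, jbp, zn2_vec]

theorem rpow_mul_rpow_mul_rpow_neg_le {K X Y M Q σ e : ℝ} (hK : 1 ≤ K) (hX : 1 ≤ X) (hY : 1 ≤ Y)
    (hKQ : K ^ 2 ≤ Q) (hXQ : X ^ 2 ≤ Q) (hYQ : Y ^ 2 ≤ Q) (hQ : Q ≤ 4 * M) (hσ : 0 ≤ σ)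
    (hσe : σ ≤ e) (he : e ≤ 1) :
    K ^ (-σ) * (X ^ σ * Y ^ σ) * M ^ (-e) ≤ 4 * K ^ (-(2 * e - σ)) := by
  have hK0 : 0 < K := by linarith
  have hX0 : 0 < X := by linarith
  have hY0 : 0 < Y := by linarith
  have hQ0 : 0 < Q := lt_of_lt_of_le (by positivity) hKQ
  have hM0 : 0 < M := by linarith
  have hM : M ^ (-e) ≤ 4 * Q ^ (-e) := by
    refine (rpow_neg_le_of_le_mul hQ0 four_pos (by linarith) hQ).trans ?_
    gcongr
    calc (4 : ℝ) ^ e ≤ 4 ^ (1 : ℝ) := Real.rpow_le_rpow_of_exponent_le (by norm_num) he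
      _ = 4 := Real.rpow_one 4
  have hXY : X ^ σ * Y ^ σ ≤ Q ^ σ := by
    rw [← Real.mul_rpow hX0.le hY0.le]
    exact Real.rpow_le_rpow (by positivity) (by nlinarith [sq_nonneg (X - Y)]) hσ
  calc _ ≤ K ^ (-σ) * Q ^ σ * (4 * Q ^ (-e)) := by gcongr
    _ = 4 * (K ^ (-σ) * Q ^ (-(e - σ))) := by
        rw [show -(e - σ) = σ + -e by ring, Real.rpow_add hQ0]; ring
    _ ≤ 4 * (K ^ (-σ) * (K ^ 2) ^ (-(e - σ))) := by
        gcongr 4 * (_ * ?_)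
        exact Real.rpow_le_rpow_of_nonpos (by positivity) hKQ (by linarith)
    _ = _ := by
        rw [← Real.rpow_natCast, ← Real.rpow_mul hK0.le, ← Real.rpow_add hK0]
        congr 2
        push_cast
        ring

theorem resonance_le (k k₁ : Fin 2 → ℤ) (τ τ₁ : ℝ) :
    zn2 k + zn2 k₁ + zn2 (k - k₁) ≤
      jb (τ + zn2 k) + jb (τ₁ - zn2 k₁) + jb (τ - τ₁ - zn2 (k - k₁)) := by
  have h₀ := (le_abs_self _).trans (abs_le_jb (τ + zn2 k))
  have h₁ := (neg_le_abs _).trans (abs_le_jb (τ₁ - zn2 k₁))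
  have h₂ := (neg_le_abs _).trans (abs_le_jb (τ - τ₁ - zn2 (k - k₁)))
  linarith

theorem kernel_le {σ β b : ℝ} (hσ : 0 ≤ σ) (hσβ : σ ≤ β) (hβ : β ≤ 1) (hσb : σ ≤ b) (hb : b ≤ 1)
    (k k₁ : Fin 2 → ℤ) (τ τ₁ : ℝ) :
    jbk k ^ (-σ) * (jbk k₁ ^ σ * jbk (k - k₁) ^ σ) * (jb (τ + zn2 k) ^ (-β) *
        (jb (τ₁ - zn2 k₁) ^ (-b) * jb (τ - τ₁ - zn2 (k - k₁)) ^ (-b))) ≤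
      4 * (jbk k ^ (-(2 * β - σ)) *
          (jb (τ₁ - zn2 k₁) ^ (-b) * jb (τ - τ₁ - zn2 (k - k₁)) ^ (-b)) +
        (jbk k ^ (-(2 * b - σ)) *
          (jb (τ + zn2 k) ^ (-β) * jb (τ - τ₁ - zn2 (k - k₁)) ^ (-b)) +
        jbk k ^ (-(2 * b - σ)) * (jb (τ + zn2 k) ^ (-β) * jb (τ₁ - zn2 k₁) ^ (-b)))) := by
  have hr := resonance_le k k₁ τ τ₁
  have hk := zn2_nonneg k
  have hk₁ := zn2_nonneg k₁
  have hk₂ := zn2_nonneg (k - k₁)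
  have sk := jbk_sq k
  have sk₁ := jbk_sq k₁
  have sk₂ := jbk_sq (k - k₁)
  have ok := one_le_jbk k
  have ok₁ := one_le_jbk k₁
  have ok₂ := one_le_jbk (k - k₁)
  have o₀ := one_le_jb (τ + zn2 k)
  have o₁ := one_le_jb (τ₁ - zn2 k₁)
  have o₂ := one_le_jb (τ - τ₁ - zn2 (k - k₁))
  generalize jb (τ + zn2 k) = m₀ at *
  generalize jb (τ₁ - zn2 k₁) = m₁ at *
  generalize jb (τ - τ₁ - zn2 (k - k₁)) = m₂ at *
  generalize jbk k = K at *
  generalize jbk k₁ = X at *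
  generalize jbk (k - k₁) = Y at *
  set Q := 1 + zn2 k + zn2 k₁ + zn2 (k - k₁) with hQ
  have main : ∀ {e M : ℝ}, σ ≤ e → e ≤ 1 → Q ≤ 4 * M →
      K ^ (-σ) * (X ^ σ * Y ^ σ) * M ^ (-e) ≤ 4 * K ^ (-(2 * e - σ)) := fun h₁ h₂ h₃ =>
    rpow_mul_rpow_mul_rpow_neg_le ok ok₁ ok₂ (by linarith) (by linarith) (by linarith) h₃ hσ h₁ h₂
  have hA : 0 ≤ K ^ (-(2 * β - σ)) * (m₁ ^ (-b) * m₂ ^ (-b)) := by positivity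
  have hB : 0 ≤ K ^ (-(2 * b - σ)) * (m₀ ^ (-β) * m₂ ^ (-b)) := by positivity
  have hC : 0 ≤ K ^ (-(2 * b - σ)) * (m₀ ^ (-β) * m₁ ^ (-b)) := by positivity
  have h3 : Q ≤ 4 * m₀ ∨ Q ≤ 4 * m₁ ∨ Q ≤ 4 * m₂ := by
    by_contra! h
    linarith
  rcases h3 with h | h | h
  · have := mul_le_mul_of_nonneg_right (main hσβ hβ h)
      (show 0 ≤ m₁ ^ (-b) * m₂ ^ (-b) by positivity)
    linarith
  · have := mul_le_mul_of_nonneg_right (main hσb hb h)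
      (show 0 ≤ m₀ ^ (-β) * m₂ ^ (-b) by positivity)
    linarith
  · have := mul_le_mul_of_nonneg_right (main hσb hb h)
      (show 0 ≤ m₀ ^ (-β) * m₁ ^ (-b) by positivity)
    linarith

theorem sq_add_add_le (x y z : ENNReal) : (x + (y + z)) ^ 2 ≤ 9 * (x ^ 2 + (y ^ 2 + z ^ 2)) := by
  obtain ⟨m, hm, hx, hy, hz⟩ : ∃ m : ENNReal, m ^ 2 ≤ x ^ 2 + (y ^ 2 + z ^ 2) ∧
      x ≤ m ∧ y ≤ m ∧ z ≤ m := by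
    have hx : x ^ 2 ≤ x ^ 2 + (y ^ 2 + z ^ 2) := le_self_add
    have hy : y ^ 2 ≤ x ^ 2 + (y ^ 2 + z ^ 2) := le_trans le_self_add le_add_self
    have hz : z ^ 2 ≤ x ^ 2 + (y ^ 2 + z ^ 2) := le_trans le_add_self le_add_self
    rcases le_total x y with h | h
    · rcases le_total y z with h' | h'
      · exact ⟨z, hz, h.trans h', h', le_rfl⟩
      · exact ⟨y, hy, h, le_rfl, h'⟩
    · rcases le_total x z with h' | h'
      · exact ⟨z, hz, h', h.trans h', le_rfl⟩
      · exact ⟨x, hx, le_rfl, h, h'⟩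
  calc (x + (y + z)) ^ 2 ≤ (m + (m + m)) ^ 2 := by gcongr
    _ = 9 * m ^ 2 := by ring
    _ ≤ _ := by gcongr

theorem lintegral_sq_conv_le_of_kernel_le {α : Type*} [MeasurableSpace α] [Countable α]
    [MeasurableSingletonClass α] [AddCommGroup α] {κ κ₀ κ₁ : α × ℝ → α × ℝ → ENNReal}
    {A S : ENNReal} {F₁ F₂ : α × ℝ → ENNReal} (mκ₀ : Measurable (Function.uncurry κ₀))
    (mκ₁ : Measurable (Function.uncurry κ₁)) (h₁ : Measurable F₁) (h₂ : Measurable F₂)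
    (hκ : ∀ z w, κ z w ≤ 4 * (κ₀ z w + (κ₁ z w + κ₁ z (z - w))))
    (hA : ∫⁻ z, (∫⁻ w, κ₀ z w * (F₁ w * F₂ (z - w)) ∂countVol α) ^ 2 ∂countVol α ≤
      A * ((∫⁻ z, F₁ z ^ 2 ∂countVol α) * ∫⁻ z, F₂ z ^ 2 ∂countVol α))
    (hS : ∀ w, ∫⁻ z, κ₁ z w ^ 2 ∂countVol α ≤ S) :
    ∫⁻ z, (∫⁻ w, κ z w * (F₁ w * F₂ (z - w)) ∂countVol α) ^ 2 ∂countVol α ≤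
      16 * (9 * (A + (S + S))) *
        ((∫⁻ z, F₁ z ^ 2 ∂countVol α) * ∫⁻ z, F₂ z ^ 2 ∂countVol α) := by
  have := measurableSub₂_prod_real α
  have mF : Measurable fun p : (α × ℝ) × (α × ℝ) => F₁ p.2 * F₂ (p.1 - p.2) := by fun_prop
  have m0 : Measurable fun p : (α × ℝ) × (α × ℝ) => κ₀ p.1 p.2 * (F₁ p.2 * F₂ (p.1 - p.2)) :=
    mκ₀.mul mF
  have m1 : Measurable fun p : (α × ℝ) × (α × ℝ) => κ₁ p.1 p.2 * (F₁ p.2 * F₂ (p.1 - p.2)) :=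
    mκ₁.mul mF
  have n0 : ∀ z, Measurable fun w => κ₀ z w * (F₁ w * F₂ (z - w)) :=
    fun z => m0.comp measurable_prodMk_left
  have n1 : ∀ z, Measurable fun w => κ₁ z w * (F₁ w * F₂ (z - w)) :=
    fun z => m1.comp measurable_prodMk_left
  have i0 := m0.lintegral_prod_right' (ν := countVol α)
  have i1 := m1.lintegral_prod_right' (ν := countVol α)
  have hB := lintegral_sq_conv_le_of_dominant mκ₁ h₁ h₂ hS
  have hB' := lintegral_sq_conv_le_of_dominant' mκ₁ h₁ h₂ hS
  generalize (∫⁻ z, F₁ z ^ 2 ∂countVol α) * ∫⁻ z, F₂ z ^ 2 ∂countVol α = N at *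
  calc _ ≤ ∫⁻ z, (4 * (∫⁻ w, κ₀ z w * (F₁ w * F₂ (z - w)) ∂countVol α +
          (∫⁻ w, κ₁ z w * (F₁ w * F₂ (z - w)) ∂countVol α +
          ∫⁻ w, κ₁ z (z - w) * (F₁ w * F₂ (z - w)) ∂countVol α))) ^ 2 ∂countVol α := by
        gcongr with z
        rw [← lintegral_add_left (n1 z), ← lintegral_add_left (n0 z),
          ← lintegral_const_mul' _ _ (by norm_num)]
        refine lintegral_mono fun w => ?_
        rw [← add_mul, ← add_mul, ← mul_assoc 4]
        exact mul_le_mul_left (hκ z w) _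
    _ ≤ ∫⁻ z, 16 * (9 * ((∫⁻ w, κ₀ z w * (F₁ w * F₂ (z - w)) ∂countVol α) ^ 2 +
          ((∫⁻ w, κ₁ z w * (F₁ w * F₂ (z - w)) ∂countVol α) ^ 2 +
          (∫⁻ w, κ₁ z (z - w) * (F₁ w * F₂ (z - w)) ∂countVol α) ^ 2))) ∂countVol α := by
        refine lintegral_mono fun z => ?_
        rw [mul_pow, show (4 : ENNReal) ^ 2 = 16 by norm_num]
        gcongr
        exact sq_add_add_le _ _ _
    _ ≤ 16 * (9 * (A * N + (S * N + S * N))) := by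
        rw [lintegral_const_mul' _ _ (by norm_num), lintegral_const_mul' _ _ (by norm_num),
          lintegral_add_left (i0.pow_const 2), lintegral_add_left (i1.pow_const 2)]
        gcongr
    _ = _ := by ring

theorem exists_lintegral_sq_conv_kernel_le {σ β b : ℝ} (hσ : 0 ≤ σ) (hβ' : β ≤ 1)
    (hb : 3 / 8 < b) (hb' : b < 1 / 2) (hbβ : 7 / 8 < β + b) (hσβ : 1 / 2 < 2 * β - σ)
    (hσb : 3 / 8 < 2 * b - σ) (hσβ' : σ ≤ β) (hσb' : σ ≤ b) :
    ∃ C : ENNReal, C ≠ ⊤ ∧ ∀ F₁ F₂ : (Fin 2 → ℤ) × ℝ → ENNReal, Measurable F₁ → Measurable F₂ →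
      ∫⁻ z, (∫⁻ w, ENNReal.ofReal (jbk z.1 ^ (-σ) * (jbk w.1 ^ σ * jbk (z.1 - w.1) ^ σ) *
        (jb (z.2 + zn2 z.1) ^ (-β) * (jb (w.2 - zn2 w.1) ^ (-b) *
          jb (z.2 - w.2 - zn2 (z.1 - w.1)) ^ (-b)))) * (F₁ w * F₂ (z - w))
          ∂countVol (Fin 2 → ℤ)) ^ 2 ∂countVol (Fin 2 → ℤ) ≤
      C * ((∫⁻ z, F₁ z ^ 2 ∂countVol (Fin 2 → ℤ)) *
        ∫⁻ z, F₂ z ^ 2 ∂countVol (Fin 2 → ℤ)) := by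
  obtain ⟨A, hA, hA'⟩ := exists_lintegral_sq_conv_output_le hb hb' hσβ
  obtain ⟨S, hS, hS'⟩ := exists_lintegral_input_kernel_le (β := β) hb (by linarith) hbβ hσb
  refine ⟨16 * (9 * (A + (S + S))), by finiteness, fun F₁ F₂ h₁ h₂ => ?_⟩
  have hJ := measurable_jb
  have hz := measurable_zn2
  have hK := measurable_jbk
  refine lintegral_sq_conv_le_of_kernel_le
    (κ₀ := fun z w => ENNReal.ofReal (jbk z.1 ^ (-(2 * β - σ)) * (jb (w.2 - zn2 w.1) ^ (-b) *
        jb (z.2 - w.2 - zn2 (z.1 - w.1)) ^ (-b))))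
    (κ₁ := fun z w => ENNReal.ofReal (jbk z.1 ^ (-(2 * b - σ)) * (jb (z.2 + zn2 z.1) ^ (-β) *
        jb (z.2 - w.2 - zn2 (z.1 - w.1)) ^ (-b))))
    (by unfold Function.uncurry; fun_prop) (by unfold Function.uncurry; fun_prop) h₁ h₂
    (fun z w => ?_) (hA' F₁ F₂ h₁ h₂) hS'
  have hn : ∀ (x : ℝ) (e : ℝ), 0 ≤ jb x ^ e := fun x e => Real.rpow_nonneg (jb_pos x).le _
  have hn' : ∀ (x : Fin 2 → ℤ) (e : ℝ), 0 ≤ jbk x ^ e :=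
    fun x e => Real.rpow_nonneg (jbk_pos x).le _
  simp only [Prod.fst_sub, Prod.snd_sub, sub_sub_cancel]
  rw [← ENNReal.ofReal_add (mul_nonneg (hn' _ _) (mul_nonneg (hn _ _) (hn _ _)))
      (mul_nonneg (hn' _ _) (mul_nonneg (hn _ _) (hn _ _))),
    ← ENNReal.ofReal_add (mul_nonneg (hn' _ _) (mul_nonneg (hn _ _) (hn _ _)))
      (add_nonneg (mul_nonneg (hn' _ _) (mul_nonneg (hn _ _) (hn _ _)))
        (mul_nonneg (hn' _ _) (mul_nonneg (hn _ _) (hn _ _)))),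
    ← ENNReal.ofReal_ofNat 4, ← ENNReal.ofReal_mul (by norm_num)]
  exact ENNReal.ofReal_le_ofReal (kernel_le hσ hσβ' hβ' hσb' (by linarith) z.1 w.1 z.2 w.2)

/-- Proposition 30 in Fourier variables: for `s ∈ (−3/8, −1/3)`, `b ∈ (3/8, 1/2)`,
there are `b' ∈ (−1/2, −5/12)` and `C > 0` such that the bilinear convolution
estimate corresponding to `‖v̄₁v̄₂‖_{X_{s,b'}} ≤ C‖v₁‖_{X_{s,b}}‖v₂‖_{X_{s,b}}` holds.
(Stated in `ℝ≥0∞`.) -/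
theorem stmt6 (s b : ℝ) (hs : s ∈ Set.Ioo (-(3 : ℝ) / 8) (-(1 : ℝ) / 3))
    (hb : b ∈ Set.Ioo ((3 : ℝ) / 8) ((1 : ℝ) / 2)) :
    ∃ b' ∈ Set.Ioo (-(1 : ℝ) / 2) (-(5 : ℝ) / 12), ∃ C : ℝ, 0 < C ∧
      ∀ f₁ f₂ : (Fin 2 → ℤ) × ℝ → ℝ, Measurable f₁ → Measurable f₂ →
        (∀ z, 0 ≤ f₁ z) → (∀ z, 0 ≤ f₂ z) →
        (∑' k : Fin 2 → ℤ, ∫⁻ τ : ℝ,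
            ENNReal.ofReal (jbk k ^ (2 * s) * jb (τ + zn2 k) ^ (2 * b')) *
            (∑' k₁ : Fin 2 → ℤ, ∫⁻ τ₁ : ℝ,
              ENNReal.ofReal
                (jbk k₁ ^ (-s) * jb (τ₁ - zn2 k₁) ^ (-b) * f₁ (k₁, τ₁) *
                  (jbk (k - k₁) ^ (-s) * jb ((τ - τ₁) - zn2 (k - k₁)) ^ (-b) *
                    f₂ (k - k₁, τ - τ₁)))) ^ 2)
          ≤ ENNReal.ofReal C *
              ((∑' k : Fin 2 → ℤ, ∫⁻ τ : ℝ, ENNReal.ofReal (f₁ (k, τ)) ^ 2) *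
               (∑' k : Fin 2 → ℤ, ∫⁻ τ : ℝ, ENNReal.ofReal (f₂ (k, τ)) ^ 2)) := by
  obtain ⟨hs₁, hs₂⟩ := hs
  obtain ⟨hb₁, hb₂⟩ := hb
  set β : ℝ := 1 / 2 - (b - 3 / 8) / 2 with hβ
  obtain ⟨C, hC, h⟩ := exists_lintegral_sq_conv_kernel_le (σ := -s) (β := β) (b := b)
    (by linarith) (by linarith) hb₁ hb₂ (by linarith) (by linarith) (by linarith) (by linarith)
    (by linarith)
  refine ⟨-β, ⟨by linarith, by linarith⟩, C.toReal + 1, by positivity,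
    fun f₁ f₂ h₁ h₂ p₁ p₂ => ?_⟩
  have hJ := measurable_jb
  have hz := measurable_zn2
  have hK := measurable_jbk
  have hCle : C ≤ ENNReal.ofReal (C.toReal + 1) := by
    rw [← ENNReal.ofReal_toReal hC]
    exact ENNReal.ofReal_le_ofReal (by simp)
  refine le_trans (le_of_eq ?_) ((h (fun z => ENNReal.ofReal (f₁ z))
    (fun z => ENNReal.ofReal (f₂ z)) h₁.ennreal_ofReal h₂.ennreal_ofReal).trans
    ((mul_le_mul_left hCle _).trans_eq ?_))
  · have mG : Measurable fun p : ((Fin 2 → ℤ) × ℝ) × ((Fin 2 → ℤ) × ℝ) =>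
        ENNReal.ofReal (jbk p.1.1 ^ (- -s) * (jbk p.2.1 ^ (-s) * jbk (p.1.1 - p.2.1) ^ (-s)) *
        (jb (p.1.2 + zn2 p.1.1) ^ (-β) * (jb (p.2.2 - zn2 p.2.1) ^ (-b) *
          jb (p.1.2 - p.2.2 - zn2 (p.1.1 - p.2.1)) ^ (-b)))) *
        (ENNReal.ofReal (f₁ p.2) * ENNReal.ofReal (f₂ (p.1 - p.2))) := by fun_prop
    rw [lintegral_countVol (mG.lintegral_prod_right'.pow_const 2)]
    refine tsum_congr fun k => lintegral_congr fun τ => ?_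
    rw [lintegral_countVol (by fun_prop)]
    have hk := jbk_pos k
    have hm := jb_pos (τ + zn2 k)
    have hw : ENNReal.ofReal (jbk k ^ (2 * s) * jb (τ + zn2 k) ^ (2 * -β)) =
        ENNReal.ofReal (jbk k ^ s * jb (τ + zn2 k) ^ (-β)) ^ 2 := by
      rw [← ENNReal.ofReal_pow (by positivity), mul_pow, ← Real.rpow_mul_natCast hk.le,
        ← Real.rpow_mul_natCast hm.le]
      congr 3 <;> push_cast <;> ring
    rw [hw, ← mul_pow, ← ENNReal.tsum_mul_left]
    congr 1
    refine tsum_congr fun k₁ => ?_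
    rw [← lintegral_const_mul' _ _ ENNReal.ofReal_ne_top]
    refine lintegral_congr fun τ₁ => ?_
    have := jbk_pos k₁
    have := jbk_pos (k - k₁)
    have := jb_pos (τ₁ - zn2 k₁)
    have := jb_pos (τ - τ₁ - zn2 (k - k₁))
    rw [← ENNReal.ofReal_mul (by positivity), ← ENNReal.ofReal_mul (p₁ _),
      ← ENNReal.ofReal_mul (by positivity), neg_neg, Prod.mk_sub_mk]
    congr 1
    ring
  · rw [lintegral_countVol (by fun_prop), lintegral_countVol (by fun_prop)]
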